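/- arXiv:1007.0576 — 3 statements merged into one kernel-verified Lean document; each statement's English description precedes it below -/
import Mathlib

section
/- As n → ∞ one has μ_n = o(σ_n) and σ_n² ~ (α/(2−α)) (a_n² F(a_n) + b_n² F̄(b_n)); in particular σ_n² ~ c b_n² F̄(b_n) for some constant c > 0. -/
open MeasureTheory Filter Topology Set Asymptotics

/-- A positive nonincreasing function that is regularly varying at infinity of index `-α`. -/
structure RegularlyVaryingTail (α : ℝ) (G : ℝ → ℝ) : Prop where
  antitone : Antitone G
  pos : ∀ x, 0 < G x
  tendsto_ratio : ∀ l : ℝ, 0 < l → Tendsto (fun x => G (l * x) / G x) atTop (𝓝 (l ^ (-α)))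

namespace RegularlyVaryingTail

variable {α : ℝ} {G : ℝ → ℝ}

/-- Positivity is automatic for a nonnegative nonincreasing function. -/
lemma of_nonneg (hanti : Antitone G) (hnn : ∀ x, 0 ≤ G x)
    (h : ∀ l : ℝ, 0 < l → Tendsto (fun x => G (l * x) / G x) atTop (𝓝 (l ^ (-α)))) :
    RegularlyVaryingTail α G := by
  refine ⟨hanti, fun x => ?_, h⟩
  have h1 := h 1 one_pos
  rw [Real.one_rpow] at h1
  obtain ⟨y, hy, hxy⟩ := ((h1.eventually_const_lt zero_lt_one).and (eventually_ge_atTop x)).exists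
  have : G y ≠ 0 := by
    intro h0
    simp [h0] at hy
  exact (lt_of_le_of_ne (hnn y) this.symm).trans_le (hanti hxy)

/-- Potter's upper bound. -/
lemma exists_le_mul_rpow (hG : RegularlyVaryingTail α G) {β : ℝ} (hβ : 0 < β) (hαβ : α < β) :
    ∃ C T : ℝ, 0 < C ∧ 0 < T ∧ ∀ s t, T ≤ s → s ≤ t → G s ≤ C * (t / s) ^ β * G t := by
  have h2 := hG.tendsto_ratio 2 two_pos
  have hlt : (2 : ℝ) ^ (-β) < 2 ^ (-α) :=
    Real.rpow_lt_rpow_of_exponent_lt one_lt_two (by linarith)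
  obtain ⟨T, hT⟩ := eventually_atTop.1 (h2.eventually_const_lt hlt)
  have step : ∀ s, max T 1 ≤ s → G s ≤ 2 ^ β * G (2 * s) := by
    intro s hs
    have := hT s ((le_max_left _ _).trans hs)
    rw [lt_div_iff₀ (hG.pos s), Real.rpow_neg two_pos.le] at this
    have h3 : (0 : ℝ) < 2 ^ β := by positivity
    rw [inv_mul_lt_iff₀ h3] at this
    exact this.le
  have iter : ∀ (k : ℕ) s, max T 1 ≤ s → G s ≤ (2 ^ k : ℝ) ^ β * G (2 ^ k * s) := by
    intro k
    induction k with
    | zero => intro s _; simp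
    | succ k ih =>
      intro s hs
      have hs1 : 1 ≤ s := (le_max_right _ _).trans hs
      have h1 : max T 1 ≤ 2 ^ k * s := by
        have : (1 : ℝ) ≤ 2 ^ k := one_le_pow₀ one_le_two
        nlinarith
      have h4 := step _ h1
      rw [pow_succ, Real.mul_rpow (by positivity) (by positivity),
        show (2 : ℝ) ^ k * 2 * s = 2 * (2 ^ k * s) by ring, mul_assoc]
      exact (ih s hs).trans (by gcongr)
  refine ⟨2 ^ β, max T 1, by positivity, by positivity, fun s t hs hst => ?_⟩
  have hs0 : 0 < s := lt_of_lt_of_le (by positivity) hs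
  have hts : 1 ≤ t / s := (one_le_div hs0).2 hst
  obtain ⟨k, hk1, hk2⟩ := exists_nat_pow_near hts one_lt_two
  have h5 : t ≤ 2 ^ (k + 1) * s := by
    rw [div_lt_iff₀ hs0] at hk2
    exact hk2.le
  calc G s ≤ (2 ^ (k + 1) : ℝ) ^ β * G (2 ^ (k + 1) * s) := iter _ _ hs
    _ ≤ (2 * (t / s)) ^ β * G t := by
      have := hG.antitone h5
      have := (hG.pos (2 ^ (k + 1) * s)).le
      gcongr
      rw [pow_succ]; linarith
    _ = _ := by rw [Real.mul_rpow two_pos.le (by positivity)]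

/-- Regular variation along sequences with asymptotically proportional arguments. -/
lemma tendsto_div (hG : RegularlyVaryingTail α G) {x y : ℕ → ℝ} {l : ℝ} (hl : 0 < l)
    (hx : Tendsto x atTop atTop) (hyx : Tendsto (fun n => y n / x n) atTop (𝓝 l)) :
    Tendsto (fun n => G (y n) / G (x n)) atTop (𝓝 (l ^ (-α))) := by
  have hcont : Tendsto (fun m : ℝ => m ^ (-α)) (𝓝 l) (𝓝 (l ^ (-α))) :=
    (Real.continuousAt_rpow_const _ _ (Or.inl hl.ne')).tendsto
  rw [tendsto_order]
  constructor
  · intro c hc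
    have h1 : ∀ᶠ m in 𝓝[>] l, c < m ^ (-α) ∧ l < m :=
      ((hcont.eventually_const_lt hc).filter_mono nhdsWithin_le_nhds).and
        eventually_mem_nhdsWithin
    obtain ⟨m, hm, hlm⟩ := h1.exists
    filter_upwards [((hG.tendsto_ratio m (hl.trans hlm)).comp hx).eventually_const_lt hm,
      hyx.eventually_lt_const hlm, hx.eventually_gt_atTop 0] with n h2 h3 h4
    refine h2.trans_le ?_
    rw [div_lt_iff₀ h4] at h3
    exact div_le_div_of_nonneg_right (hG.antitone h3.le) (hG.pos _).le
  · intro c hc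
    have h1 : ∀ᶠ m in 𝓝[<] l, (m ^ (-α) < c ∧ 0 < m) ∧ m < l :=
      (((hcont.eventually_lt_const hc).and (lt_mem_nhds hl)).filter_mono
        nhdsWithin_le_nhds).and eventually_mem_nhdsWithin
    obtain ⟨m, ⟨hm, hm0⟩, hlm⟩ := h1.exists
    filter_upwards [((hG.tendsto_ratio m hm0).comp hx).eventually_lt_const hm,
      hyx.eventually_const_lt hlm, hx.eventually_gt_atTop 0] with n h2 h3 h4
    refine lt_of_le_of_lt ?_ h2
    rw [lt_div_iff₀ h4] at h3
    exact div_le_div_of_nonneg_right (hG.antitone h3.le) (hG.pos _).le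

lemma tendsto_sq_mul_div (hG : RegularlyVaryingTail α G) (hα0 : 0 < α) (hα2 : α < 2)
    {x y : ℕ → ℝ} {l : ℝ} (hl : 0 ≤ l) (hx : Tendsto x atTop atTop) (hy : Tendsto y atTop atTop)
    (hyx : Tendsto (fun n => y n / x n) atTop (𝓝 l)) :
    Tendsto (fun n => (y n ^ 2 * G (y n)) / (x n ^ 2 * G (x n))) atTop
      (𝓝 (l ^ 2 * l ^ (-α))) := by
  rcases hl.eq_or_lt with rfl | hl
  · obtain ⟨C, T, hC, hT, hCT⟩ := hG.exists_le_mul_rpow (β := (α + 2) / 2) (by linarith)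
      (by linarith)
    have hγ : 0 < 2 - (α + 2) / 2 := by linarith
    have h1 : Tendsto (fun n => C * (y n / x n) ^ (2 - (α + 2) / 2)) atTop (𝓝 0) := by
      have := (hyx.rpow_const (p := 2 - (α + 2) / 2) (Or.inr hγ.le)).const_mul C
      rwa [Real.zero_rpow hγ.ne', mul_zero] at this
    have hz : (0 : ℝ) ^ 2 * 0 ^ (-α) = 0 := by simp
    rw [hz]
    refine squeeze_zero' (Eventually.of_forall fun n => ?_) ?_ h1
    · have := (hG.pos (y n)).le
      have := (hG.pos (x n)).le
      positivity
    · filter_upwards [hx.eventually_gt_atTop 0, hy.eventually_ge_atTop T,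
        hyx.eventually_lt_const zero_lt_one] with n h2 h3 h4
      have hy0 : 0 < y n := hT.trans_le h3
      rw [div_lt_one h2] at h4
      have h5 := hCT _ _ h3 h4.le
      have hGx := hG.pos (x n)
      rw [div_le_iff₀ (by positivity)]
      have h6 : (y n / x n) ^ (2 - (α + 2) / 2) * x n ^ 2
          = (x n / y n) ^ ((α + 2) / 2) * y n ^ 2 := by
        rw [Real.rpow_sub (by positivity), ← inv_div (y n), Real.inv_rpow (by positivity)]
        norm_num
        field_simp
      calc y n ^ 2 * G (y n) ≤ y n ^ 2 * (C * (x n / y n) ^ ((α + 2) / 2) * G (x n)) := by gcongr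
        _ = C * ((x n / y n) ^ ((α + 2) / 2) * y n ^ 2) * G (x n) := by ring
        _ = _ := by rw [← h6]; ring
  · refine ((hyx.pow 2).mul (hG.tendsto_div hl hx hyx)).congr fun n => ?_
    rw [div_pow, div_mul_div_comm]

lemma tendsto_sq_mul_atTop (hG : RegularlyVaryingTail α G) (hα0 : 0 < α) (hα2 : α < 2) :
    Tendsto (fun x => x ^ 2 * G x) atTop atTop := by
  obtain ⟨C, T, hC, hT, hCT⟩ := hG.exists_le_mul_rpow (β := (α + 2) / 2) (by linarith)
    (by linarith)
  have hGT := hG.pos T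
  have hγ : 0 < 2 - (α + 2) / 2 := by linarith
  have h1 := (tendsto_rpow_atTop hγ).const_mul_atTop
    (show 0 < G T * T ^ ((α + 2) / 2) / C by positivity)
  refine tendsto_atTop_mono' _ ?_ h1
  filter_upwards [eventually_ge_atTop T] with x hx
  have hx0 : 0 < x := hT.trans_le hx
  have h2 := hCT T x le_rfl hx
  rw [Real.div_rpow hx0.le hT.le] at h2
  have h3 : x ^ (2 - (α + 2) / 2) = x ^ 2 / x ^ ((α + 2) / 2) := by
    rw [Real.rpow_sub hx0]; norm_num
  rw [h3, div_mul_div_comm, div_le_iff₀ (by positivity)]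
  have h4 : 0 < T ^ ((α + 2) / 2) := by positivity
  calc G T * T ^ ((α + 2) / 2) * x ^ 2
      ≤ C * (x ^ ((α + 2) / 2) / T ^ ((α + 2) / 2)) * G x * T ^ ((α + 2) / 2) * x ^ 2 := by gcongr
    _ = _ := by field_simp

/-- Regular variation is preserved by asymptotic proportionality. -/
lemma of_tendsto_div (hG : RegularlyVaryingTail α G) {H : ℝ → ℝ} (hH : Antitone H)
    (hnn : ∀ x, 0 ≤ H x) {p : ℝ} (hp : 0 < p)
    (h : Tendsto (fun x => H x / G x) atTop (𝓝 p)) : RegularlyVaryingTail α H := by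
  refine of_nonneg hH hnn fun l hl => ?_
  have h1 : Tendsto (fun x => H (l * x) / G (l * x)) atTop (𝓝 p) :=
    h.comp (tendsto_id.const_mul_atTop hl)
  have h2 := (h1.mul (hG.tendsto_ratio l hl)).div h hp.ne'
  rw [mul_div_cancel_left₀ _ hp.ne'] at h2
  refine h2.congr fun x => ?_
  have := (hG.pos x).ne'
  have := (hG.pos (l * x)).ne'
  simp only [Pi.div_apply]
  field_simp

/-- A function squeezed between `G` and all its contractions is equivalent to `G`. -/
lemma tendsto_div_one (hG : RegularlyVaryingTail α G) {H : ℝ → ℝ} (hGH : ∀ x, G x ≤ H x)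
    (hHG : ∀ x y, y < x → H x ≤ G y) : Tendsto (fun x => H x / G x) atTop (𝓝 1) := by
  have hcont : Tendsto (fun m : ℝ => m ^ (-α)) (𝓝 1) (𝓝 1) := by
    have := (Real.continuousAt_rpow_const (1 : ℝ) (-α) (Or.inl one_ne_zero)).tendsto
    rwa [Real.one_rpow] at this
  rw [tendsto_order]
  constructor
  · intro c hc
    exact Eventually.of_forall fun x => hc.trans_le ((one_le_div (hG.pos x)).2 (hGH x))
  · intro c hc
    have h1 : ∀ᶠ m : ℝ in 𝓝[<] 1, (m ^ (-α) < c ∧ 0 < m) ∧ m < 1 :=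
      (((hcont.eventually_lt_const hc).and (lt_mem_nhds one_pos)).filter_mono
        nhdsWithin_le_nhds).and eventually_mem_nhdsWithin
    obtain ⟨m, ⟨hm, hm0⟩, hlm⟩ := h1.exists
    filter_upwards [(hG.tendsto_ratio m hm0).eventually_lt_const hm,
      eventually_gt_atTop 0] with x h2 h4
    exact lt_of_le_of_lt (div_le_div_of_nonneg_right
      (hHG _ _ (by nlinarith)) (hG.pos _).le) h2

end RegularlyVaryingTail

section Truncation

variable {Ω : Type*} [MeasurableSpace Ω] {μ : Measure Ω} [IsProbabilityMeasure μ] {X : Ω → ℝ}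

lemma integrable_sq_min (hX : Measurable X) (t : ℝ) :
    Integrable (fun ω => (min (max (X ω / t) 0) 1) ^ 2) μ := by
  refine Integrable.of_bound (C := 1) (by fun_prop) (Eventually.of_forall fun ω => ?_)
  have h0 : 0 ≤ min (max (X ω / t) 0) 1 := le_min (le_max_right _ _) zero_le_one
  have h1 : min (max (X ω / t) 0) 1 ≤ 1 := min_le_right _ _
  rw [Real.norm_of_nonneg (by positivity)]
  exact pow_le_one₀ h0 h1

lemma integral_sq_min_eq (hX : Measurable X) {t : ℝ} (ht : 0 < t) :
    ∫ ω, (min (max (X ω / t) 0) 1) ^ 2 ∂μ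
      = ∫ v in Ioo (0 : ℝ) 1, μ.real {ω | t * √v < X ω} := by
  rw [(integrable_sq_min hX t).integral_eq_integral_meas_lt
    (Eventually.of_forall fun ω => by positivity)]
  have hset : ∀ v : ℝ, 0 < v → ∀ ω, v < (min (max (X ω / t) 0) 1) ^ 2 ↔ v < 1 ∧ t * √v < X ω := by
    intro v hv ω
    have h0 : 0 ≤ min (max (X ω / t) 0) 1 := le_min (le_max_right _ _) zero_le_one
    have hs : 0 < √v := Real.sqrt_pos.2 hv
    have h1 : √v < 1 ↔ v < 1 := by rw [Real.sqrt_lt' one_pos, one_pow]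
    rw [← Real.sqrt_lt_sqrt_iff hv.le, Real.sqrt_sq h0, lt_min_iff, lt_max_iff, lt_div_iff₀ ht, h1,
      or_iff_left hs.not_gt, and_comm, mul_comm]
  rw [setIntegral_eq_of_subset_of_forall_sdiff_eq_zero measurableSet_Ioi
    (Ioo_subset_Ioi_self : Ioo (0 : ℝ) 1 ⊆ Ioi 0)]
  · refine setIntegral_congr_fun measurableSet_Ioo fun v hv => ?_
    simp only [hset v hv.1, hv.2, true_and]
  · intro v hv
    have h1 : ¬ v < 1 := fun h => hv.2 ⟨hv.1, h⟩
    simp only [hset v hv.1, h1, false_and, ofPred_false, measureReal_empty]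

/-- Karamata's theorem for the tail of a random variable, in integrated form. -/
lemma tendsto_integral_sq_min_div {α : ℝ} (hα0 : 0 < α) (hα2 : α < 2) (hX : Measurable X)
    (hG : RegularlyVaryingTail α fun t => μ.real {ω | t < X ω}) :
    Tendsto (fun t => (∫ ω, (min (max (X ω / t) 0) 1) ^ 2 ∂μ) / μ.real {ω | t < X ω}) atTop
      (𝓝 (2 / (2 - α))) := by
  set G : ℝ → ℝ := fun t => μ.real {ω | t < X ω} with hGdef
  have hG1 : ∀ t, G t ≤ 1 := fun t => measureReal_le_one
  set β := (α + 2) / 2 with hβ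
  obtain ⟨C, T, hC, hT, hCT⟩ := hG.exists_le_mul_rpow (β := β) (by linarith) (by linarith)
  have hGT := hG.pos T
  have hCT' : ∀ t u, T ≤ t → 0 < u → u < 1 → G (t * u) / G t ≤ (C + C / G T) * u ^ (-β) := by
    intro t u ht hu hu1
    have ht0 : 0 < t := hT.trans_le ht
    have hGt := hG.pos t
    have hup : 0 < u ^ (-β) := by positivity
    have hCG : 0 < C / G T := by positivity
    rw [div_le_iff₀ hGt]
    rcases le_total T (t * u) with h | h
    · have h1 := hCT (t * u) t h (by nlinarith)
      rw [show t / (t * u) = u⁻¹ by field_simp, Real.inv_rpow hu.le, ← Real.rpow_neg hu.le] at h1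
      refine h1.trans ?_
      gcongr
      linarith
    · have h1 := hCT T t le_rfl ht
      have h2 : (t / T) ^ β ≤ u ^ (-β) := by
        rw [Real.rpow_neg hu.le, ← Real.inv_rpow hu.le]
        refine Real.rpow_le_rpow (by positivity) ?_ (by linarith)
        rw [div_le_iff₀ hT, inv_mul_eq_div, le_div_iff₀ hu]
        exact h
      have h3 : G T ≤ C * u ^ (-β) * G t := h1.trans (by gcongr)
      calc G (t * u) ≤ 1 := hG1 _
        _ = G T / G T := (div_self hGT.ne').symm
        _ ≤ C * u ^ (-β) * G t / G T := by gcongr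
        _ = C / G T * u ^ (-β) * G t := by ring
        _ ≤ _ := by gcongr; linarith
  have hlim : Tendsto (fun t => ∫ v in Ioo (0 : ℝ) 1, G (t * √v) / G t) atTop
      (𝓝 (∫ v in Ioo (0 : ℝ) 1, v ^ (-α / 2))) := by
    refine tendsto_integral_filter_of_dominated_convergence
      (fun v => (C + C / G T) * v ^ (-β / 2)) ?_ ?_ ?_ ?_
    · refine Eventually.of_forall fun t => ?_
      have : Measurable G := hG.antitone.measurable
      exact (by fun_prop : Measurable fun v => G (t * √v) / G t).aestronglyMeasurable
    · filter_upwards [eventually_ge_atTop T] with t ht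
      refine (ae_restrict_mem measurableSet_Ioo).mono fun v hv => ?_
      rw [Real.norm_of_nonneg (div_nonneg (hG.pos _).le (hG.pos _).le)]
      have h1 := hCT' t (√v) ht (Real.sqrt_pos.2 hv.1)
        ((Real.sqrt_lt' one_pos).2 (by simpa using hv.2))
      rwa [Real.sqrt_eq_rpow, ← Real.rpow_mul hv.1.le,
        show 1 / 2 * -β = -β / 2 by ring, ← Real.sqrt_eq_rpow] at h1
    · refine Integrable.const_mul ?_ _
      have : IntervalIntegrable (fun v : ℝ => v ^ (-β / 2)) volume 0 1 :=
        intervalIntegral.intervalIntegrable_rpow' (by linarith)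
      exact ((intervalIntegrable_iff_integrableOn_Ioc_of_le zero_le_one).1 this).mono_set
        Ioo_subset_Ioc_self
    · refine (ae_restrict_mem measurableSet_Ioo).mono fun v hv => ?_
      have h1 := hG.tendsto_ratio (√v) (Real.sqrt_pos.2 hv.1)
      rw [Real.sqrt_eq_rpow, ← Real.rpow_mul hv.1.le,
        show 1 / 2 * -α = -α / 2 by ring, ← Real.sqrt_eq_rpow] at h1
      simpa only [mul_comm] using h1
  have hval : ∫ v in Ioo (0 : ℝ) 1, v ^ (-α / 2) = 2 / (2 - α) := by
    rw [← integral_Ioc_eq_integral_Ioo, ← intervalIntegral.integral_of_le zero_le_one,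
      integral_rpow (Or.inl (by linarith)), Real.one_rpow, Real.zero_rpow (by linarith)]
    have : 2 - α ≠ 0 := by linarith
    have h' : -α / 2 + 1 ≠ 0 := by linarith
    rw [sub_zero, div_eq_div_iff h' this]
    ring
  rw [hval] at hlim
  refine hlim.congr' ?_
  filter_upwards [eventually_gt_atTop 0] with t ht
  rw [integral_sq_min_eq hX ht, integral_div]

/-- Karamata's theorem for truncated second moments. -/
lemma tendsto_truncated_second_moment_div {α : ℝ} (hα0 : 0 < α) (hα2 : α < 2) (hX : Measurable X)
    (hG : RegularlyVaryingTail α fun t => μ.real {ω | t < X ω}) :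
    Tendsto (fun t => (∫ ω, (if 0 < X ω ∧ X ω ≤ t then X ω ^ 2 else 0) ∂μ)
      / (t ^ 2 * μ.real {ω | t < X ω})) atTop (𝓝 (α / (2 - α))) := by
  have h := (tendsto_integral_sq_min_div hα0 hα2 hX hG).sub_const 1
  have h2 : 2 - α ≠ 0 := by linarith
  rw [show 2 / (2 - α) - 1 = α / (2 - α) by field_simp; ring] at h
  refine h.congr' ?_
  filter_upwards [eventually_gt_atTop 0] with t ht
  have hGt := hG.pos t
  have hms : MeasurableSet {ω | t < X ω} := measurableSet_lt measurable_const hX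
  have hpt : ∀ ω, (if 0 < X ω ∧ X ω ≤ t then X ω ^ 2 else 0)
      = t ^ 2 * (min (max (X ω / t) 0) 1) ^ 2
        - t ^ 2 * {ω | t < X ω}.indicator (fun _ => (1 : ℝ)) ω := by
    intro ω
    rcases le_or_gt (X ω) 0 with h0 | h0
    · have h1 : X ω / t ≤ 0 := div_nonpos_of_nonpos_of_nonneg h0 ht.le
      have h3 : ¬ t < X ω := by linarith
      simp [h0.not_gt, max_eq_right h1, h3]
    · have h1 : 0 ≤ X ω / t := by positivity
      rcases le_or_gt (X ω) t with h4 | h4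
      · rw [max_eq_left h1, min_eq_left ((div_le_one ht).2 h4)]
        simp only [h0, h4, and_self, if_true, mem_ofPred_eq, h4.not_gt, not_false_eq_true,
          indicator_of_notMem]
        field_simp
        ring
      · rw [max_eq_left h1, min_eq_right ((one_le_div ht).2 h4.le)]
        simp [h4.not_ge, h4]
  simp_rw [hpt]
  rw [integral_sub ((integrable_sq_min hX t).const_mul _)
    (((integrable_const (1 : ℝ)).indicator hms).const_mul _),
    integral_const_mul, integral_const_mul, integral_indicator_const _ hms, smul_eq_mul, mul_one]
  field_simp

lemma tendsto_measureReal_lt_abs (hX : Measurable X) :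
    Tendsto (fun M : ℝ => μ.real {ω | M < |X ω|}) atTop (𝓝 0) := by
  have hmeas : Measurable fun ω => |X ω| := by fun_prop
  have : IsProbabilityMeasure (μ.map fun ω => |X ω|) :=
    Measure.isProbabilityMeasure_map hmeas.aemeasurable
  have h := (ProbabilityTheory.tendsto_cdf_atTop (μ.map fun ω => |X ω|)).const_sub 1
  rw [sub_self] at h
  refine h.congr fun M => ?_
  rw [ProbabilityTheory.cdf_eq_real, map_measureReal_apply hmeas measurableSet_Iic,
    ← probReal_compl_eq_one_sub (hmeas measurableSet_Iic)]
  congr 1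
  ext ω
  simp

/-- If the second moments of square integrable variables dominated by a fixed random variable
diverge, the means are negligible with respect to the `L²` norms. -/
lemma isLittleO_integral_sqrt_integral_sq (hX : Measurable X) {Z : ℕ → Ω → ℝ}
    (hZ : ∀ n, MemLp (Z n) 2 μ) (hZX : ∀ n ω, |Z n ω| ≤ |X ω|)
    (hV : Tendsto (fun n => ∫ ω, Z n ω ^ 2 ∂μ) atTop atTop) :
    (fun n => ∫ ω, Z n ω ∂μ) =o[atTop] (fun n => √(∫ ω, Z n ω ^ 2 ∂μ)) := by
  rw [isLittleO_iff]
  intro ε hε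
  set δ := ε / 2 with hδ
  have hδ0 : 0 < δ := by positivity
  obtain ⟨M, hM, hM0⟩ := (((tendsto_measureReal_lt_abs (μ := μ) hX).eventually_lt_const
    (show 0 < δ ^ 2 by positivity)).and (eventually_gt_atTop 0)).exists
  have hs : Tendsto (fun n => √(∫ ω, Z n ω ^ 2 ∂μ)) atTop atTop :=
    Real.tendsto_sqrt_atTop.comp hV
  filter_upwards [hs.eventually_gt_atTop 0, hs.eventually_ge_atTop (M / δ)] with n h0 h1
  set r := √(∫ ω, Z n ω ^ 2 ∂μ) with hr
  have hr2 : ∫ ω, Z n ω ^ 2 ∂μ = r ^ 2 :=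
    (Real.sq_sqrt (integral_nonneg fun ω => sq_nonneg _)).symm
  have hms : MeasurableSet {ω | M < |X ω|} := measurableSet_lt measurable_const (by fun_prop)
  set I : Ω → ℝ := {ω | M < |X ω|}.indicator fun _ => 1 with hI
  have hIint : Integrable I μ := (integrable_const _).indicator hms
  have hpt : ∀ ω, |Z n ω| ≤ M + (δ / (2 * r) * Z n ω ^ 2 + r / (2 * δ) * I ω) := by
    intro ω
    by_cases h : M < |X ω|
    · have hIω : I ω = 1 := indicator_of_mem (s := {ω | M < |X ω|}) h _
      rw [hIω, ← sq_abs]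
      have : δ / (2 * r) * |Z n ω| ^ 2 + r / (2 * δ) * 1 - |Z n ω|
          = (δ * |Z n ω| - r) ^ 2 / (2 * r * δ) := by
        field_simp
        ring
      have h2 : 0 ≤ (δ * |Z n ω| - r) ^ 2 / (2 * r * δ) := by positivity
      linarith
    · have hIω : I ω = 0 := indicator_of_notMem (s := {ω | M < |X ω|}) h _
      rw [hIω]
      have h2 : 0 ≤ δ / (2 * r) * Z n ω ^ 2 := by positivity
      linarith [hZX n ω, not_lt.1 h]
  have hsq : Integrable (fun ω => Z n ω ^ 2) μ := (hZ n).integrable_sq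
  have hlin : Integrable (fun ω => δ / (2 * r) * Z n ω ^ 2 + r / (2 * δ) * I ω) μ :=
    (hsq.const_mul _).add (hIint.const_mul _)
  have hbd : |∫ ω, Z n ω ∂μ| ≤ M + δ * r := by
    calc |∫ ω, Z n ω ∂μ| ≤ ∫ ω, |Z n ω| ∂μ := abs_integral_le_integral_abs
      _ ≤ ∫ ω, (M + (δ / (2 * r) * Z n ω ^ 2 + r / (2 * δ) * I ω)) ∂μ :=
        integral_mono ((hZ n).integrable one_le_two).abs
          ((integrable_const _).add hlin) hpt
      _ = M + (δ / (2 * r) * r ^ 2 + r / (2 * δ) * μ.real {ω | M < |X ω|}) := by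
        rw [integral_add (integrable_const _) hlin,
          integral_add (hsq.const_mul _) (hIint.const_mul _), integral_const_mul,
          integral_const_mul, hr2, hI, integral_indicator_const _ hms]
        simp
      _ ≤ M + (δ / (2 * r) * r ^ 2 + r / (2 * δ) * δ ^ 2) := by gcongr
      _ = M + δ * r := by field_simp; ring
  rw [div_le_iff₀ hδ0] at h1
  rw [Real.norm_eq_abs, Real.norm_of_nonneg h0.le]
  linarith [show ε * r = 2 * (r * δ) by rw [hδ]; ring]

lemma integral_truncation_sq (hX : Measurable X) {a b : ℝ} (ha : a < 0) (hb : 0 < b) :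
    ∫ ω, (if X ω ∈ Icc a b then X ω else 0) ^ 2 ∂μ
      = ∫ ω, (if 0 < X ω ∧ X ω ≤ b then X ω ^ 2 else 0) ∂μ
        + ∫ ω, (if 0 < -X ω ∧ -X ω ≤ -a then (-X ω) ^ 2 else 0) ∂μ := by
  have hint : ∀ (Y : Ω → ℝ), Measurable Y → ∀ t : ℝ,
      Integrable (fun ω => if 0 < Y ω ∧ Y ω ≤ t then Y ω ^ 2 else 0) μ := by
    intro Y hY t
    refine Integrable.of_bound (C := t ^ 2) (Measurable.aestronglyMeasurable ?_)
      (Eventually.of_forall fun ω => ?_)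
    · exact Measurable.ite ((measurableSet_lt measurable_const hY).inter
        (measurableSet_le hY measurable_const)) (by fun_prop) measurable_const
    · split_ifs with h
      · rw [Real.norm_of_nonneg (by positivity)]
        exact pow_le_pow_left₀ h.1.le h.2 2
      · simpa using sq_nonneg t
  rw [← integral_add (hint X hX b) (hint (fun ω => -X ω) hX.neg (-a))]
  refine integral_congr_ae (Eventually.of_forall fun ω => ?_)
  simp only [mem_Icc]
  rcases lt_trichotomy (X ω) 0 with h | h | h
  · have h1 : X ω ≤ b := by linarith
    simp [h, h1, h.not_gt]
  · simp [h]
  · have h1 : a ≤ X ω := by linarith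
    simp [h, h1, h.not_gt]

end Truncation

/-- Let `F` be the distribution function of `X`, in the domain of
attraction of a stable law of index `α ∈ (0,2)` (regularly varying balanced tails), and let
`a_n → −∞`, `b_n → +∞` with `b_n/(−a_n)` tending to a positive limit or to `+∞`.  With
`μ_n = E[X 1_{[a_n,b_n]}(X)]` and `σ_n² = Var(X 1_{[a_n,b_n]}(X))`, one has `μ_n = o(σ_n)`,
`σ_n² ~ (α/(2−α))(a_n² F(a_n) + b_n² F̄(b_n))`, and in particular
`σ_n² ~ c b_n² F̄(b_n)` for some constant `c > 0`. -/
theorem statement0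
    {Ω : Type*} [MeasurableSpace Ω] (μ : Measure Ω) [IsProbabilityMeasure μ]
    (X : Ω → ℝ) (hX : Measurable X)
    (F Fstar : ℝ → ℝ)
    (hF : ∀ x : ℝ, F x = (μ {ω | X ω ≤ x}).toReal)
    (hFstar : ∀ x : ℝ, Fstar x = (μ {ω | |X ω| ≤ x}).toReal)
    (α : ℝ) (hα0 : 0 < α) (hα2 : α < 2)
    (hRV : ∀ l : ℝ, 0 < l →
      Tendsto (fun x : ℝ => (1 - Fstar (l * x)) / (1 - Fstar x)) atTop (𝓝 (l ^ (-α))))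
    (p q : ℝ) (hp : 0 < p) (hq : 0 < q) (hpq : p + q = 1)
    (hbalp : Tendsto (fun x : ℝ => (1 - F x) / (1 - Fstar x)) atTop (𝓝 p))
    (hbalq : Tendsto (fun x : ℝ =>
      (μ {ω | X ω < -x}).toReal / (1 - Fstar x)) atTop (𝓝 q))
    (a b : ℕ → ℝ)
    (ha : Tendsto a atTop atBot) (hb : Tendsto b atTop atTop)
    (hab : (∃ L : ℝ, 0 < L ∧ Tendsto (fun n => b n / (-(a n))) atTop (𝓝 L)) ∨
      Tendsto (fun n => b n / (-(a n))) atTop atTop)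
    (μn σn : ℕ → ℝ)
    (hμn : ∀ n : ℕ, μn n = ∫ ω, (if X ω ∈ Set.Icc (a n) (b n) then X ω else 0) ∂μ)
    (hσn : ∀ n : ℕ, σn n = Real.sqrt
      (∫ ω, ((if X ω ∈ Set.Icc (a n) (b n) then X ω else 0) - μn n) ^ 2 ∂μ)) :
    (fun n : ℕ => μn n) =o[atTop] (fun n : ℕ => σn n) ∧
    Tendsto (fun n : ℕ => (σn n) ^ 2 /
        ((α / (2 - α)) * ((a n) ^ 2 * F (a n) + (b n) ^ 2 * (1 - F (b n)))))
      atTop (𝓝 1) ∧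
    ∃ c : ℝ, 0 < c ∧
      Tendsto (fun n : ℕ => (σn n) ^ 2 / (c * (b n) ^ 2 * (1 - F (b n))))
        atTop (𝓝 1) := by
  have hGpF : ∀ x, 1 - F x = μ.real {ω | x < X ω} := by
    intro x
    rw [hF, ← measureReal_def, ← probReal_compl_eq_one_sub (measurableSet_le hX measurable_const)]
    congr 1
    ext ω
    simp
  have hGsF : ∀ x, 1 - Fstar x = μ.real {ω | x < |X ω|} := by
    intro x
    rw [hFstar, ← measureReal_def,
      ← probReal_compl_eq_one_sub (measurableSet_le (by fun_prop) measurable_const)]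
    congr 1
    ext ω
    simp
  have hGmF : ∀ x, (μ {ω | X ω < -x}).toReal = μ.real {ω | x < -X ω} := by
    intro x
    simp only [lt_neg, measureReal_def]
  have hanti : ∀ Y : Ω → ℝ, Antitone fun x => μ.real {ω | x < Y ω} := fun Y x y hxy =>
    measureReal_mono fun ω (hω : y < Y ω) => lt_of_le_of_lt hxy hω
  simp only [hGpF, hGsF, hGmF] at hRV hbalp hbalq ⊢
  have hGs := RegularlyVaryingTail.of_nonneg (hanti _) (fun _ => measureReal_nonneg) hRV
  have hGp := hGs.of_tendsto_div (hanti _) (fun _ => measureReal_nonneg) hp hbalp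
  have hGm := hGs.of_tendsto_div (hanti _) (fun _ => measureReal_nonneg) hq hbalq
  have hFm : Tendsto (fun x => F (-x) / μ.real {ω | x < -X ω}) atTop (𝓝 1) := by
    refine hGm.tendsto_div_one (fun x => ?_) fun x y hyx => ?_
    · rw [hF, ← measureReal_def]
      exact measureReal_mono fun ω (hω : x < -X ω) => show X ω ≤ -x by linarith
    · rw [hF, ← measureReal_def]
      exact measureReal_mono fun ω (hω : X ω ≤ -x) => show y < -X ω by linarith
  have ha' : Tendsto (fun n => -a n) atTop atTop := tendsto_neg_atBot_atTop.comp ha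
  set c := α / (2 - α) with hc
  have hc0 : 0 < c := div_pos hα0 (by linarith)
  obtain ⟨l, hl0, hl⟩ : ∃ l : ℝ, 0 ≤ l ∧ Tendsto (fun n => -a n / b n) atTop (𝓝 l) := by
    rcases hab with ⟨L, hL, h⟩ | h
    · exact ⟨L⁻¹, by positivity, (h.inv₀ hL.ne').congr fun n => inv_div _ _⟩
    · exact ⟨0, le_rfl, (tendsto_inv_atTop_zero.comp h).congr fun n => inv_div _ _⟩
  set B : ℕ → ℝ := fun n => b n ^ 2 * μ.real {ω | b n < X ω} with hB
  set A : ℕ → ℝ := fun n => a n ^ 2 * F (a n) with hA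
  have hBtop : Tendsto B atTop atTop := (hGp.tendsto_sq_mul_atTop hα0 hα2).comp hb
  have hFa : Tendsto (fun n => F (a n) / μ.real {ω | -a n < -X ω}) atTop (𝓝 1) := by
    simpa only [Function.comp_def, neg_neg] using hFm.comp ha'
  set r : ℝ := 1 * q * (l ^ 2 * l ^ (-α)) / p with hr
  have hr0 : 0 ≤ r := by positivity
  have hAB : Tendsto (fun n => A n / B n) atTop (𝓝 r) := by
    refine (((hFa.mul (hbalq.comp ha')).mul
      (hGs.tendsto_sq_mul_div hα0 hα2 hl0 hb ha' hl)).div (hbalp.comp hb) hp.ne').congr' ?_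
    filter_upwards [hb.eventually_gt_atTop 0] with n hbn
    have h1 := (hGs.pos (b n)).ne'
    have h2 := (hGs.pos (-a n)).ne'
    have h3 := (hGp.pos (b n)).ne'
    have h4 := (hGm.pos (-a n)).ne'
    simp only [Pi.div_apply, Function.comp_apply, hA, hB]
    field_simp
  have hUp := (tendsto_truncated_second_moment_div hα0 hα2 hX hGp).comp hb
  have hUm := (tendsto_truncated_second_moment_div hα0 hα2 hX.neg hGm).comp ha'
  set Z : ℕ → Ω → ℝ := fun n ω => if X ω ∈ Icc (a n) (b n) then X ω else 0 with hZ
  set V : ℕ → ℝ := fun n => ∫ ω, Z n ω ^ 2 ∂μ with hV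
  have hVB : Tendsto (fun n => V n / B n) atTop (𝓝 (c * (1 + r))) := by
    have h := hUp.add ((hUm.div hFa one_ne_zero).mul hAB)
    rw [show c + c / 1 * r = c * (1 + r) by ring] at h
    refine h.congr' ?_
    filter_upwards [hb.eventually_gt_atTop 0, ha.eventually_lt_atBot 0,
      hFa.eventually_const_lt zero_lt_one] with n hbn han hFn
    have h3 := (hGp.pos (b n)).ne'
    have h4 := (hGm.pos (-a n)).ne'
    have h6 := han.ne
    have h5 : F (a n) ≠ 0 := by
      intro h0
      simp [h0] at hFn
    simp only [hV, hZ, integral_truncation_sq hX han hbn, Pi.div_apply, Function.comp_apply, hA,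
      hB, Pi.neg_apply]
    field_simp
  have hVtop : Tendsto V atTop atTop := by
    refine (hVB.pos_mul_atTop (by positivity) hBtop).congr' ?_
    filter_upwards [hBtop.eventually_gt_atTop 0] with n hn
    exact div_mul_cancel₀ _ hn.ne'
  have hZX : ∀ n ω, |Z n ω| ≤ |X ω| := by
    intro n ω
    simp only [hZ]
    split_ifs <;> simp
  have hZm : ∀ n, Measurable (Z n) := fun n =>
    Measurable.ite (hX measurableSet_Icc) hX measurable_const
  have hZL : ∀ n, MemLp (Z n) 2 μ := by
    intro n
    refine MemLp.of_bound (hZm n).aestronglyMeasurable (max |a n| |b n|)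
      (Eventually.of_forall fun ω => ?_)
    simp only [hZ]
    split_ifs with h
    · exact abs_le_max_abs_abs h.1 h.2
    · simp
  have hμo : μn =o[atTop] fun n => √(V n) := by
    rw [show μn = fun n => ∫ ω, Z n ω ∂μ from funext hμn]
    exact isLittleO_integral_sqrt_integral_sq hX hZL hZX hVtop
  have hσ2 : ∀ n, σn n ^ 2 = V n - μn n ^ 2 := by
    intro n
    rw [hσn, Real.sq_sqrt (integral_nonneg fun ω => sq_nonneg _)]
    have h := ProbabilityTheory.variance_eq_sub (hZL n)
    rw [ProbabilityTheory.variance_eq_integral (hZm n).aemeasurable] at h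
    rw [hμn n]
    exact h
  have hσV : Tendsto (fun n => σn n ^ 2 / V n) atTop (𝓝 1) := by
    have h := (hμo.tendsto_div_nhds_zero.pow 2).const_sub 1
    rw [show (1 : ℝ) - 0 ^ 2 = 1 by norm_num] at h
    refine h.congr' ?_
    filter_upwards [hVtop.eventually_gt_atTop 0] with n hn
    rw [hσ2, div_pow, Real.sq_sqrt hn.le, sub_div, div_self hn.ne']
  have hσB : Tendsto (fun n => σn n ^ 2 / B n) atTop (𝓝 (c * (1 + r))) := by
    have h := hσV.mul hVB
    rw [one_mul] at h
    refine h.congr' ?_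
    filter_upwards [hVtop.eventually_gt_atTop 0] with n hn
    exact div_mul_div_cancel₀ hn.ne'
  have hcr : 0 < c * (1 + r) := by positivity
  refine ⟨hμo.trans_isBigO (IsBigO.of_bound 2 ?_), ?_, c * (1 + r), hcr, ?_⟩
  · filter_upwards [hVtop.eventually_gt_atTop 0,
      hσV.eventually_const_lt (show (1 / 2 : ℝ) < 1 by norm_num)] with n h0 h1
    rw [lt_div_iff₀ h0] at h1
    have h2 : 0 ≤ σn n := by rw [hσn]; positivity
    rw [Real.norm_of_nonneg (Real.sqrt_nonneg _), Real.norm_of_nonneg h2]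
    exact Real.sqrt_le_iff.2 ⟨by positivity, by nlinarith⟩
  · have h := hσB.div ((hAB.add_const 1).const_mul c) (by positivity)
    rw [add_comm r, div_self hcr.ne'] at h
    refine h.congr' ?_
    filter_upwards [hBtop.eventually_gt_atTop 0] with n hn
    change σn n ^ 2 / B n / (c * (A n / B n + 1)) = σn n ^ 2 / (c * (A n + B n))
    rw [div_div]
    congr 1
    field_simp
  · have h := hσB.div_const (c * (1 + r))
    rw [div_self hcr.ne'] at h
    refine h.congr fun n => ?_
    rw [div_div, mul_assoc _ (b n ^ 2), mul_comm (B n)]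
end

section
/- For every integer k ≥ 2 there exists a positive constant z_k such that E|Z_{1,n}|^k ~ z_k F̄(b_n)^{1 − k/2} as n → ∞. -/
open MeasureTheory Filter Topology Set

lemma eventually_pos_of_regularlyVarying {T : ℝ → ℝ} (hT0 : ∀ x, 0 ≤ T x) {α : ℝ}
    (hRV : ∀ l : ℝ, 0 < l → Tendsto (fun x => T (l * x) / T x) atTop (𝓝 (l ^ (-α)))) :
    ∀ᶠ x in atTop, 0 < T x := by
  have h := (hRV 1 one_pos).eventually_ne (b₂ := 0) (by simp)
  filter_upwards [h] with x hx
  refine (hT0 x).lt_of_ne fun h0 => hx ?_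
  simp [← h0]

/-- A one-sided Potter bound for a bounded, antitone, regularly varying function. -/
lemma exists_rpow_mul_le_of_regularlyVarying {T : ℝ → ℝ} (hT : Antitone T) (hT0 : ∀ x, 0 ≤ T x)
    (hT1 : ∀ x, T x ≤ 1) {α β : ℝ} (hβ : 0 < β) (hαβ : α < β)
    (hRV : ∀ l : ℝ, 0 < l → Tendsto (fun x => T (l * x) / T x) atTop (𝓝 (l ^ (-α)))) :
    ∃ C x₀ : ℝ, 0 < C ∧ 0 < x₀ ∧ ∀ x, x₀ ≤ x → 0 < T x ∧
      ∀ t, 0 < t → t ≤ x → t ^ β * T t ≤ C * (x ^ β * T x) := by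
  have hhalf : ∀ᶠ x in atTop, T (2⁻¹ * x) / T x < 2 ^ β := by
    refine (hRV 2⁻¹ (by norm_num)).eventually_lt_const ?_
    rw [Real.inv_rpow (by norm_num), ← Real.rpow_neg (by norm_num), neg_neg]
    exact Real.rpow_lt_rpow_of_exponent_lt (by norm_num) hαβ
  obtain ⟨y, hy⟩ := eventually_atTop.1
    (hhalf.and (eventually_pos_of_regularlyVarying hT0 hRV))
  set x₀ := max y 1
  have hx₀ : 0 < x₀ := lt_of_lt_of_le one_pos (le_max_right _ _)
  have hpos : ∀ x, x₀ ≤ x → 0 < T x := fun x hx => (hy x ((le_max_left _ _).trans hx)).2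
  have hdouble : ∀ x, x₀ ≤ x → T (2⁻¹ * x) ≤ 2 ^ β * T x := fun x hx => by
    have := (hy x ((le_max_left _ _).trans hx)).1
    rw [div_lt_iff₀ (hpos x hx)] at this
    exact this.le
  have hT2 : 0 < T (2 * x₀) := hpos _ (by linarith)
  set C : ℝ := 2 ^ β / T (2 * x₀) with hC
  have h2β : (0 : ℝ) < 2 ^ β := by positivity
  have hC0 : 0 < C := by positivity
  have hCβ : 2 ^ β ≤ C := by
    rw [hC, le_div_iff₀ hT2]
    exact mul_le_of_le_one_right h2β.le (hT1 _)
  have key : ∀ n : ℕ, ∀ x, x₀ ≤ x → x ≤ 2 ^ (n + 1) * x₀ → ∀ t, 0 < t → t ≤ x →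
      t ^ β * T t ≤ C * (x ^ β * T x) := by
    intro n
    induction n with
    | zero =>
      intro x hx hx2 t ht htx
      have hx2 : x ≤ 2 * x₀ := by simpa using hx2
      have h1 : t ^ β * T t ≤ (2 * x₀) ^ β * 1 := by
        gcongr
        · exact hT0 t
        · exact htx.trans hx2
        · exact hT1 t
      have h2 : x₀ ^ β * T (2 * x₀) ≤ x ^ β * T x := by
        have : 0 ≤ x := hx₀.le.trans hx
        gcongr
        exact hT hx2
      calc t ^ β * T t ≤ (2 * x₀) ^ β * 1 := h1
        _ = C * (x₀ ^ β * T (2 * x₀)) := by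
          rw [hC, Real.mul_rpow (by norm_num) hx₀.le]; field_simp
        _ ≤ C * (x ^ β * T x) := by gcongr
    | succ n ih =>
      intro x hx hxn t ht htx
      have hx0 : 0 < x := hx₀.trans_le hx
      have hTx := hpos x hx
      rcases le_or_gt x (2 * x₀) with hx2 | hx2
      · refine ih x hx (hx2.trans ?_) t ht htx
        have : (1 : ℝ) ≤ 2 ^ n := one_le_pow₀ (by norm_num)
        rw [pow_succ]
        nlinarith
      · rcases le_or_gt t (2⁻¹ * x) with htx2 | htx2
        · have h1 := ih (2⁻¹ * x) (by linarith) (by rw [pow_succ] at hxn; linarith) t ht htx2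
          refine h1.trans ?_
          have h2 : (2⁻¹ * x) ^ β * T (2⁻¹ * x) ≤ (2⁻¹ * x) ^ β * (2 ^ β * T x) := by
            gcongr
            exact hdouble x hx
          have h3 : (2⁻¹ * x) ^ β * (2 ^ β * T x) = x ^ β * T x := by
            rw [← mul_assoc, ← Real.mul_rpow (by positivity) (by norm_num)]
            congr 2
            ring
          exact mul_le_mul_of_nonneg_left (h2.trans h3.le) hC0.le
        · calc t ^ β * T t ≤ x ^ β * T (2⁻¹ * x) := by
                gcongr
                · exact hT0 _
                · exact hT htx2.le
            _ ≤ x ^ β * (2 ^ β * T x) := by gcongr; exact hdouble x hx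
            _ = 2 ^ β * (x ^ β * T x) := by ring
            _ ≤ C * (x ^ β * T x) := by gcongr
  refine ⟨C, x₀, hC0, hx₀, fun x hx => ⟨hpos x hx, fun t ht htx => ?_⟩⟩
  obtain ⟨n, hn⟩ := pow_unbounded_of_one_lt (x / x₀) (one_lt_two (α := ℝ))
  refine key n x hx ?_ t ht htx
  rw [div_lt_iff₀ hx₀] at hn
  refine hn.le.trans ?_
  gcongr
  · norm_num
  · exact n.le_succ

/-- Regular variation of an antitone function along comparable sequences. -/
lemma tendsto_div_of_regularlyVarying {T : ℝ → ℝ} (hT : Antitone T) (hT0 : ∀ x, 0 ≤ T x) {α : ℝ}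
    (hRV : ∀ l : ℝ, 0 < l → Tendsto (fun x => T (l * x) / T x) atTop (𝓝 (l ^ (-α))))
    {u v : ℕ → ℝ} (hu : Tendsto u atTop atTop) {l : ℝ} (hl : 0 < l)
    (hv : Tendsto (fun n => v n / u n) atTop (𝓝 l)) :
    Tendsto (fun n => T (v n) / T (u n)) atTop (𝓝 (l ^ (-α))) := by
  have hcont : ContinuousAt (fun x : ℝ => x ^ (-α)) l :=
    Real.continuousAt_rpow_const _ _ (Or.inl hl.ne')
  refine tendsto_order.2 ⟨fun y hy => ?_, fun y hy => ?_⟩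
  · have h1 : ∀ᶠ x in 𝓝[>] l, y < x ^ (-α) :=
      (hcont.eventually_const_lt hy).filter_mono nhdsWithin_le_nhds
    obtain ⟨m, hm, hlm⟩ := (h1.and self_mem_nhdsWithin).exists
    have hlm : l < m := hlm
    filter_upwards [((hRV m (hl.trans hlm)).comp hu).eventually_const_lt hm,
      hv.eventually_lt_const hlm, hu.eventually_gt_atTop 0] with n h2 h3 h4
    refine lt_of_lt_of_le h2 ?_
    rw [div_lt_iff₀ h4] at h3
    exact div_le_div_of_nonneg_right (hT h3.le) (hT0 _)
  · have h1 : ∀ᶠ x in 𝓝[<] l, x ^ (-α) < y ∧ 0 < x :=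
      ((hcont.eventually_lt_const hy).and (lt_mem_nhds hl)).filter_mono nhdsWithin_le_nhds
    obtain ⟨m, ⟨hm, hm0⟩, hlm⟩ := (h1.and self_mem_nhdsWithin).exists
    have hlm : m < l := hlm
    filter_upwards [((hRV m hm0).comp hu).eventually_lt_const hm,
      hv.eventually_const_lt hlm, hu.eventually_gt_atTop 0] with n h2 h3 h4
    refine lt_of_le_of_lt ?_ h2
    rw [lt_div_iff₀ h4] at h3
    exact div_le_div_of_nonneg_right (hT h3.le) (hT0 _)

lemma integral_pow_eq_integral_meas_lt_mul {Ω : Type*} [MeasurableSpace Ω] (μ : Measure Ω)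
    [IsFiniteMeasure μ] {W : Ω → ℝ} (hW : Measurable W) (hW0 : ∀ ω, 0 ≤ W ω) {k : ℕ}
    (hk : k ≠ 0) :
    ∫ ω, W ω ^ k ∂μ = k * ∫ s in Ioi (0 : ℝ), μ.real {ω | s < W ω} * s ^ ((k : ℝ) - 1) := by
  have h := lintegral_rpow_eq_lintegral_meas_lt_mul μ (ae_of_all _ hW0) hW.aemeasurable
    (p := k) (by positivity)
  have hmeas : Measurable fun s : ℝ => μ.real {ω | s < W ω} :=
    Antitone.measurable fun s t hst => measureReal_mono fun ω hω => lt_of_le_of_lt hst hω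
  rw [integral_eq_lintegral_of_nonneg_ae (ae_of_all _ fun ω => pow_nonneg (hW0 ω) k)
      (hW.pow_const k).aestronglyMeasurable,
    integral_eq_lintegral_of_nonneg_ae]
  · simp only [Real.rpow_natCast] at h
    rw [h, ENNReal.toReal_mul, ENNReal.toReal_ofReal (by positivity)]
    congr 2
    refine setLIntegral_congr_fun measurableSet_Ioi fun s hs => ?_
    rw [ENNReal.ofReal_mul measureReal_nonneg, ofReal_measureReal]
  · refine (ae_restrict_iff' measurableSet_Ioi).2 (ae_of_all _ fun s hs => ?_)
    exact mul_nonneg measureReal_nonneg (Real.rpow_nonneg (le_of_lt hs) _)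
  · exact (hmeas.mul (measurable_id.pow_const _)).aestronglyMeasurable

/-- Convergence of normalized moments from convergence of normalized tails. -/
lemma exists_tendsto_integral_pow_div {Ω : Type*} [MeasurableSpace Ω] (μ : Measure Ω)
    [IsFiniteMeasure μ] {W : ℕ → Ω → ℝ} (hW : ∀ n, Measurable (W n)) (hW0 : ∀ n ω, 0 ≤ W n ω)
    (hWint : ∀ n, ∀ k : ℕ, Integrable (fun ω => W n ω ^ k) μ)
    {τ : ℕ → ℝ} (hτ : ∀ᶠ n in atTop, 0 < τ n) {h : ℝ → ℝ}
    (hlim : ∀ᵐ s ∂volume.restrict (Ioi (0 : ℝ)),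
      Tendsto (fun n => μ.real {ω | s < W n ω} / τ n) atTop (𝓝 (h s)))
    {s₀ h₀ : ℝ} (hs₀ : 0 < s₀) (hh₀ : 0 < h₀)
    (hlim₀ : Tendsto (fun n => μ.real {ω | s₀ < W n ω} / τ n) atTop (𝓝 h₀))
    {C S β : ℝ} (hS : 0 < S)
    (hbound : ∀ᶠ n in atTop, ∀ s, 0 < s → s < S → μ.real {ω | s < W n ω} / τ n ≤ C * s ^ (-β))
    (hzero : ∀ᶠ n in atTop, ∀ s, S ≤ s → μ.real {ω | s < W n ω} = 0)
    {k : ℕ} (hk : k ≠ 0) (hβk : β < k) :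
    ∃ c : ℝ, 0 < c ∧ Tendsto (fun n => (∫ ω, W n ω ^ k ∂μ) / τ n) atTop (𝓝 c) := by
  have hmeas : ∀ n, Measurable fun s : ℝ => μ.real {ω | s < W n ω} := fun n =>
    Antitone.measurable fun s t hst => measureReal_mono fun ω hω => lt_of_le_of_lt hst hω
  have hmain : Tendsto (fun n => ∫ s in Ioi (0 : ℝ),
      μ.real {ω | s < W n ω} / τ n * s ^ ((k : ℝ) - 1)) atTop
      (𝓝 (∫ s in Ioi (0 : ℝ), h s * s ^ ((k : ℝ) - 1))) := by
    refine tendsto_integral_filter_of_dominated_convergence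
      ((Ioo 0 S).indicator fun s => C * s ^ (k - 1 - β)) ?_ ?_ ?_ ?_
    · exact Eventually.of_forall fun n =>
        (((hmeas n).div_const _).mul (measurable_id.pow_const _)).aestronglyMeasurable
    · filter_upwards [hbound, hzero, hτ] with n h1 h2 h3
      refine (ae_restrict_iff' measurableSet_Ioi).2 (ae_of_all _ fun s (hs : 0 < s) => ?_)
      rw [Real.norm_of_nonneg (mul_nonneg (div_nonneg measureReal_nonneg h3.le)
        (Real.rpow_nonneg hs.le _))]
      by_cases hsS : s < S
      · rw [indicator_of_mem (show s ∈ Ioo 0 S from ⟨hs, hsS⟩), sub_eq_add_neg _ β,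
          add_comm _ (-β), Real.rpow_add hs,
          ← mul_assoc]
        exact mul_le_mul_of_nonneg_right (h1 s hs hsS) (Real.rpow_nonneg hs.le _)
      · rw [indicator_of_notMem fun hs' => hsS hs'.2, h2 s (not_lt.1 hsS)]
        simp
    · refine IntegrableOn.integrable_indicator ?_ measurableSet_Ioo |>.integrableOn
      exact ((intervalIntegral.integrableOn_Ioo_rpow_iff hS).2 (by linarith)).const_mul C
    · filter_upwards [hlim] with s hs using hs.mul_const _
  have heq : ∀ n, (∫ ω, W n ω ^ k ∂μ) / τ n = k * ∫ s in Ioi (0 : ℝ),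
      μ.real {ω | s < W n ω} / τ n * s ^ ((k : ℝ) - 1) := fun n => by
    rw [integral_pow_eq_integral_meas_lt_mul μ (hW n) (hW0 n) hk, mul_div_assoc,
      ← integral_div]
    congr 2 with s
    ring
  have hconv : Tendsto (fun n => (∫ ω, W n ω ^ k ∂μ) / τ n) atTop
      (𝓝 (k * ∫ s in Ioi (0 : ℝ), h s * s ^ ((k : ℝ) - 1))) := by
    simpa only [heq] using hmain.const_mul (k : ℝ)
  refine ⟨_, ?_, hconv⟩
  refine lt_of_lt_of_le (mul_pos (pow_pos hs₀ k) hh₀)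
    (le_of_tendsto_of_tendsto (hlim₀.const_mul (s₀ ^ k)) hconv ?_)
  filter_upwards [hτ] with n hn
  rw [← mul_div_assoc]
  gcongr
  have hmarkov := mul_meas_ge_le_integral_of_nonneg
    (ae_of_all μ fun ω => pow_nonneg (hW0 n ω) k) (hWint n k) (s₀ ^ k)
  refine le_trans ?_ hmarkov
  refine mul_le_mul_of_nonneg_left (measureReal_mono fun ω (hω : s₀ < W n ω) => ?_) (by positivity)
  exact pow_le_pow_left₀ hs₀.le hω.le k

lemma integral_abs_pow_eq_lpNorm_pow {Ω : Type*} [MeasurableSpace Ω] {μ : Measure Ω}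
    {f : Ω → ℝ} (hf : AEStronglyMeasurable f μ) {k : ℕ} (hk : k ≠ 0) :
    ∫ ω, |f ω| ^ k ∂μ = lpNorm f k μ ^ k := by
  rw [lpNorm_eq_integral_norm_rpow_toReal (by exact_mod_cast hk) (by simp) hf]
  simp only [Real.norm_eq_abs, ENNReal.toReal_natCast, Real.rpow_natCast]
  rw [Real.rpow_inv_natCast_pow (integral_nonneg fun ω => by positivity) hk]

/-- If `|Y n|` is dominated by a fixed `|X|` and `‖Y n‖₂ → ∞`, then `E (Y n) = o(‖Y n‖₂)`. -/
lemma tendsto_integral_div_lpNorm_two {Ω : Type*} [MeasurableSpace Ω] {μ : Measure Ω}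
    [IsProbabilityMeasure μ] {X : Ω → ℝ} (hX : Measurable X)
    (hXtail : Tendsto (fun x : ℝ => μ.real {ω | x < |X ω|}) atTop (𝓝 0))
    {Y : ℕ → Ω → ℝ} (hY : ∀ n, MemLp (Y n) 2 μ) (hYX : ∀ n ω, |Y n ω| ≤ |X ω|)
    (hS : Tendsto (fun n => lpNorm (Y n) 2 μ) atTop atTop) :
    Tendsto (fun n => (∫ ω, Y n ω ∂μ) / lpNorm (Y n) 2 μ) atTop (𝓝 0) := by
  rw [Metric.tendsto_nhds]
  intro ε hε
  set η := ε / 4 with hη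
  have hη0 : 0 < η := by positivity
  obtain ⟨M, hM, hM0⟩ := ((hXtail.eventually_lt_const (pow_pos hη0 2)).and
    (eventually_ge_atTop 0)).exists
  filter_upwards [hS.eventually_gt_atTop 0, hS.eventually_gt_atTop (M / η)] with n hn hnM
  set S := lpNorm (Y n) 2 μ
  have hSq : ∫ ω, Y n ω ^ 2 ∂μ = S ^ 2 := by
    have := integral_abs_pow_eq_lpNorm_pow (hY n).aestronglyMeasurable (k := 2) (by norm_num)
    simpa using this
  have hset : MeasurableSet {ω | M < |X ω|} := measurableSet_lt measurable_const hX.abs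
  have hpt : ∀ ω, |Y n ω| ≤ M + η / (2 * S) * Y n ω ^ 2 +
      {ω | M < |X ω|}.indicator (fun _ => S / (2 * η)) ω := by
    intro ω
    by_cases hω : M < |X ω|
    · rw [indicator_of_mem (show ω ∈ {ω | M < |X ω|} from hω)]
      have h1 : |Y n ω| ≤ η / (2 * S) * Y n ω ^ 2 + S / (2 * η) := by
        have h2 : η / (2 * S) * Y n ω ^ 2 + S / (2 * η) - |Y n ω| =
            (η * |Y n ω| - S) ^ 2 / (2 * S * η) := by
          rw [← sq_abs (Y n ω)]
          field_simp
          ring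
        have h3 : 0 ≤ (η * |Y n ω| - S) ^ 2 / (2 * S * η) := by positivity
        linarith
      linarith
    · rw [indicator_of_notMem (show ω ∉ {ω | M < |X ω|} from hω)]
      have h1 : 0 ≤ η / (2 * S) * Y n ω ^ 2 := by positivity
      have := hYX n ω
      linarith
  have hi2 : Integrable (fun ω => η / (2 * S) * Y n ω ^ 2) μ := (hY n).integrable_sq.const_mul _
  have hi3 : Integrable ({ω | M < |X ω|}.indicator fun _ => S / (2 * η)) μ :=
    (integrable_const _).indicator hset
  have hle : |∫ ω, Y n ω ∂μ| ≤ M + η / (2 * S) * S ^ 2 + μ.real {ω | M < |X ω|} * (S / (2 * η)) := by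
    calc |∫ ω, Y n ω ∂μ| ≤ ∫ ω, |Y n ω| ∂μ := abs_integral_le_integral_abs
      _ ≤ ∫ ω, (M + η / (2 * S) * Y n ω ^ 2 +
          {ω | M < |X ω|}.indicator (fun _ => S / (2 * η)) ω) ∂μ :=
        integral_mono ((hY n).integrable (by norm_num)).abs
          (((integrable_const M).add hi2).add hi3) hpt
      _ = _ := by
        rw [integral_add (f := fun ω => M + η / (2 * S) * Y n ω ^ 2)
            ((integrable_const M).add hi2) hi3, integral_add (integrable_const M) hi2,
          integral_const_mul, hSq, integral_indicator_const _ hset]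
        simp
  have hle2 : |∫ ω, Y n ω ∂μ| < ε * S := by
    have h1 : μ.real {ω | M < |X ω|} * (S / (2 * η)) ≤ η ^ 2 * (S / (2 * η)) := by gcongr
    have h2 : η ^ 2 * (S / (2 * η)) = η * S / 2 := by field_simp
    have h3 : η / (2 * S) * S ^ 2 = η * S / 2 := by field_simp
    rw [div_lt_iff₀ hη0] at hnM
    have h4 : ε * S = 4 * (η * S) := by rw [hη]; ring
    have h5 : 0 < η * S := by positivity
    nlinarith
  rw [Real.dist_eq, sub_zero, abs_div, abs_of_pos hn, div_lt_iff₀ hn]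
  exact hle2

lemma lpNorm_le_lpNorm_of_exponent_le {Ω : Type*} [MeasurableSpace Ω] {μ : Measure Ω}
    [IsProbabilityMeasure μ] {f : Ω → ℝ} {p q : ENNReal} (hpq : p ≤ q) (hf : MemLp f q μ) :
    lpNorm f p μ ≤ lpNorm f q μ := by
  rw [← toReal_eLpNorm hf.aestronglyMeasurable, ← toReal_eLpNorm hf.aestronglyMeasurable]
  exact ENNReal.toReal_mono hf.eLpNorm_ne_top
    (eLpNorm_le_eLpNorm_of_exponent_le hpq hf.aestronglyMeasurable)

/-- Subtracting constants that are `o(‖Y n‖₂)` does not change the absolute moments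
asymptotically. -/
lemma tendsto_integral_abs_sub_pow_div {Ω : Type*} [MeasurableSpace Ω] {μ : Measure Ω}
    [IsProbabilityMeasure μ] {Y : ℕ → Ω → ℝ} {m : ℕ → ℝ}
    (hS : ∀ᶠ n in atTop, 0 < lpNorm (Y n) 2 μ)
    (hm : Tendsto (fun n => m n / lpNorm (Y n) 2 μ) atTop (𝓝 0))
    {k : ℕ} (hk : 2 ≤ k) (hY : ∀ n, MemLp (Y n) k μ) :
    Tendsto (fun n => (∫ ω, |Y n ω - m n| ^ k ∂μ) / ∫ ω, |Y n ω| ^ k ∂μ) atTop (𝓝 1) := by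
  have hk0 : k ≠ 0 := by omega
  have hk1 : (1 : ENNReal) ≤ k := by exact_mod_cast (by omega : 1 ≤ k)
  have hconst : ∀ c : ℝ, lpNorm (fun _ : Ω => c) k μ = |c| := fun c => by
    rw [lpNorm_const' (by exact_mod_cast hk0) (by simp)]
    simp
  have hratio : Tendsto (fun n => lpNorm (fun ω => Y n ω - m n) k μ / lpNorm (Y n) k μ)
      atTop (𝓝 1) := by
    rw [tendsto_iff_norm_sub_tendsto_zero]
    have hm' := hm.abs
    rw [abs_zero] at hm'
    refine squeeze_zero' (Eventually.of_forall fun n => norm_nonneg _) ?_ hm'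
    filter_upwards [hS] with n hn
    have hle : lpNorm (Y n) 2 μ ≤ lpNorm (Y n) k μ :=
      lpNorm_le_lpNorm_of_exponent_le (by exact_mod_cast hk) (hY n)
    have hpos := hn.trans_le hle
    have h1 : lpNorm (fun ω => Y n ω - m n) k μ ≤ lpNorm (Y n) k μ + |m n| := by
      rw [← hconst]
      exact lpNorm_sub_le (hY n) hk1
    have h2 : lpNorm (Y n) k μ ≤ lpNorm (fun ω => Y n ω - m n) k μ + |m n| := by
      have := lpNorm_le_lpNorm_add_lpNorm_sub' (f := Y n) (g := fun _ => m n) (memLp_const (m n)) hk1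
        (μ := μ)
      rw [hconst] at this
      rw [add_comm]
      exact this
    rw [Real.norm_eq_abs, abs_div, abs_of_pos hn, ← div_self hpos.ne', ← sub_div, abs_div,
      abs_of_pos hpos]
    have h3 : |lpNorm (fun ω => Y n ω - m n) k μ - lpNorm (Y n) k μ| ≤ |m n| := by
      rw [abs_le]
      constructor <;> linarith
    gcongr
  have := hratio.pow k
  rw [one_pow] at this
  refine this.congr fun n => ?_
  rw [integral_abs_pow_eq_lpNorm_pow (hY n).aestronglyMeasurable hk0,
    integral_abs_pow_eq_lpNorm_pow (f := fun ω => Y n ω - m n)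
      ((hY n).sub (memLp_const (m n))).aestronglyMeasurable hk0, div_pow]

lemma tendsto_sq_mul_of_regularlyVarying {T : ℝ → ℝ} (hT : Antitone T) (hT0 : ∀ x, 0 ≤ T x)
    (hT1 : ∀ x, T x ≤ 1) {α : ℝ} (hα0 : 0 < α) (hα2 : α < 2)
    (hRV : ∀ l : ℝ, 0 < l → Tendsto (fun x => T (l * x) / T x) atTop (𝓝 (l ^ (-α)))) :
    Tendsto (fun x => x ^ 2 * T x) atTop atTop := by
  obtain ⟨C, x₀, hC, hx₀, hpot⟩ := exists_rpow_mul_le_of_regularlyVarying hT hT0 hT1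
    (α := α) (β := (α + 2) / 2) (by linarith) (by linarith) hRV
  set β := (α + 2) / 2 with hβ
  have hpos : 0 < x₀ ^ β * T x₀ / C := by
    have := (hpot x₀ le_rfl).1
    positivity
  refine tendsto_atTop_mono' _ ?_
    ((tendsto_rpow_atTop (by linarith : 0 < 2 - β)).atTop_mul_const hpos)
  filter_upwards [eventually_ge_atTop x₀] with x hx
  have hx0 : 0 < x := hx₀.trans_le hx
  have h1 := (hpot x hx).2 x₀ hx₀ hx
  have h2 : x₀ ^ β * T x₀ / C ≤ x ^ β * T x := by
    rw [div_le_iff₀ hC]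
    linarith
  calc x ^ (2 - β) * (x₀ ^ β * T x₀ / C) ≤ x ^ (2 - β) * (x ^ β * T x) := by gcongr
    _ = x ^ 2 * T x := by
      rw [← mul_assoc, ← Real.rpow_add hx0]
      norm_num

lemma measureReal_diff_eq_max {Ω : Type*} [MeasurableSpace Ω] {μ : Measure Ω}
    [IsFiniteMeasure μ] {A B : Set Ω} (hB : MeasurableSet B) (h : A ⊆ B ∨ B ⊆ A) :
    μ.real (A \ B) = max 0 (μ.real A - μ.real B) := by
  rcases h with h | h
  · rw [sdiff_eq_empty.2 h, measureReal_empty, max_eq_left]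
    exact sub_nonpos.2 (measureReal_mono h)
  · rw [measureReal_sdiff h hB, max_eq_right]
    exact sub_nonneg.2 (measureReal_mono h)

/-- The tail of the absolute value of `X` truncated to `[a, b]`. -/
lemma measureReal_lt_abs_truncation {Ω : Type*} [MeasurableSpace Ω] {μ : Measure Ω}
    [IsFiniteMeasure μ] {X : Ω → ℝ} (hX : Measurable X) {a b t : ℝ} (ha : a ≤ 0) (hb : 0 ≤ b)
    (ht : 0 < t) :
    μ.real {ω | t < |if X ω ∈ Icc a b then X ω else 0|} =
      max 0 (μ.real {ω | t < X ω} - μ.real {ω | b < X ω}) +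
      max 0 (μ.real {ω | X ω < -t} - μ.real {ω | X ω < a}) := by
  have hset : {ω | t < |if X ω ∈ Icc a b then X ω else 0|} =
      ({ω | t < X ω} \ {ω | b < X ω}) ∪ ({ω | X ω < -t} \ {ω | X ω < a}) := by
    ext ω
    by_cases h : a ≤ X ω ∧ X ω ≤ b
    · simp [h, lt_abs, lt_neg]
    · simp only [mem_Icc, h, if_false, abs_zero, mem_ofPred_eq, ht.not_gt, mem_union, Set.mem_sdiff,
        not_lt, false_iff, not_or, not_and, not_le]
      rw [not_and, not_le] at h
      refine ⟨fun h1 => h (by linarith), fun h1 => ?_⟩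
      by_contra! h2
      linarith [h h2]
  rw [hset, measureReal_union _ ((measurableSet_lt hX measurable_const).diff
      (measurableSet_lt hX measurable_const)),
    measureReal_diff_eq_max (measurableSet_lt measurable_const hX),
    measureReal_diff_eq_max (measurableSet_lt hX measurable_const)]
  · rcases le_total a (-t) with h | h
    · exact Or.inr fun ω (hω : X ω < a) => hω.trans_le h
    · exact Or.inl fun ω (hω : X ω < -t) => hω.trans_le h
  · rcases le_total b t with h | h
    · exact Or.inl fun ω (hω : t < X ω) => lt_of_le_of_lt h hω
    · exact Or.inr fun ω (hω : b < X ω) => lt_of_le_of_lt h hω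
  · refine Set.disjoint_left.2 fun ω h1 h2 => ?_
    have h3 : t < X ω := h1.1
    have h4 : X ω < -t := h2.1
    linarith

lemma measurable_truncation {Ω : Type*} [MeasurableSpace Ω] {X : Ω → ℝ} (hX : Measurable X)
    (a b : ℝ) : Measurable fun ω => if X ω ∈ Icc a b then X ω else 0 :=
  Measurable.ite (hX measurableSet_Icc) hX measurable_const

lemma memLp_truncation {Ω : Type*} [MeasurableSpace Ω] {μ : Measure Ω} [IsFiniteMeasure μ]
    {X : Ω → ℝ} (hX : Measurable X) (a b : ℝ) (r : ENNReal) :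
    MemLp (fun ω => if X ω ∈ Icc a b then X ω else 0) r μ := by
  refine MemLp.of_bound (measurable_truncation hX a b).aestronglyMeasurable (max |a| |b|)
    (ae_of_all _ fun ω => ?_)
  split_ifs with h
  · exact abs_le_max_abs_abs h.1 h.2
  · simp

/-- Absolute moments of truncations of a variable with regularly varying, balanced tails. -/
lemma exists_tendsto_integral_abs_truncation_pow {Ω : Type*} [MeasurableSpace Ω] {μ : Measure Ω}
    [IsProbabilityMeasure μ] {X : Ω → ℝ} (hX : Measurable X) {T : ℝ → ℝ}
    (hTdef : ∀ x, T x = μ.real {ω | x < |X ω|}) {α : ℝ} (hα0 : 0 < α) (hα2 : α < 2)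
    (hRV : ∀ l : ℝ, 0 < l → Tendsto (fun x => T (l * x) / T x) atTop (𝓝 (l ^ (-α))))
    {p q : ℝ} (hp : 0 < p)
    (hbalp : Tendsto (fun x => μ.real {ω | x < X ω} / T x) atTop (𝓝 p))
    (hbalq : Tendsto (fun x => μ.real {ω | X ω < -x} / T x) atTop (𝓝 q))
    {a b : ℕ → ℝ} (ha : Tendsto a atTop atBot) (hb : Tendsto b atTop atTop) {l : ℝ} (hl : 0 ≤ l)
    (hab : Tendsto (fun n => -a n / b n) atTop (𝓝 l)) {k : ℕ} (hk : 2 ≤ k) :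
    ∃ c : ℝ, 0 < c ∧ Tendsto (fun n =>
      (∫ ω, |if X ω ∈ Icc (a n) (b n) then X ω else 0| ^ k ∂μ) / (b n ^ k * T (b n)))
      atTop (𝓝 c) := by
  have hT : Antitone T := fun x y hxy => by
    rw [hTdef, hTdef]
    exact measureReal_mono fun ω hω => lt_of_le_of_lt hxy hω
  have hT0 : ∀ x, 0 ≤ T x := fun x => by rw [hTdef]; exact measureReal_nonneg
  have hT1 : ∀ x, T x ≤ 1 := fun x => by rw [hTdef]; exact measureReal_le_one
  have hTpos := eventually_pos_of_regularlyVarying hT0 hRV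
  set β := (α + 2) / 2 with hβ
  obtain ⟨C, x₀, hC, hx₀, hpot⟩ := exists_rpow_mul_le_of_regularlyVarying hT hT0 hT1
    (α := α) (β := β) (by linarith) (by linarith) hRV
  have hbpos := hb.eventually_gt_atTop 0
  have haneg := ha.eventually_lt_atBot 0
  have hTb : ∀ᶠ n in atTop, 0 < T (b n) := hb.eventually hTpos
  -- one-sided tails along sequences comparable to `b`
  have hside : ∀ {G : ℝ → ℝ} {r : ℝ}, Tendsto (fun x => G x / T x) atTop (𝓝 r) →
      ∀ {v : ℕ → ℝ} {s : ℝ}, 0 < s → Tendsto v atTop atTop →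
      Tendsto (fun n => v n / b n) atTop (𝓝 s) →
      Tendsto (fun n => G (v n) / T (b n)) atTop (𝓝 (r * s ^ (-α))) := by
    intro G r hG v s hs hv hvb
    refine ((hG.comp hv).mul (tendsto_div_of_regularlyVarying hT hT0 hRV hb hs hvb)).congr' ?_
    filter_upwards [hv.eventually hTpos] with n hn
    simp only [Function.comp]
    field_simp
  have hscale : ∀ s : ℝ, 0 < s → Tendsto (fun n => s * b n / b n) atTop (𝓝 s) := fun s hs => by
    refine tendsto_const_nhds.congr' ?_
    filter_upwards [hbpos] with n hn
    field_simp
  have htail : ∀ᶠ n in atTop, ∀ s, 0 < s →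
      μ.real {ω | s < |(if X ω ∈ Icc (a n) (b n) then X ω else 0) / b n|} =
      max 0 (μ.real {ω | s * b n < X ω} - μ.real {ω | b n < X ω}) +
      max 0 (μ.real {ω | X ω < -(s * b n)} - μ.real {ω | X ω < a n}) := by
    filter_upwards [hbpos, haneg] with n hbn han s hs
    rw [← measureReal_lt_abs_truncation hX han.le hbn.le (mul_pos hs hbn)]
    simp only [abs_div, abs_of_pos hbn, lt_div_iff₀ hbn]
  have hlim : ∀ s : ℝ, 0 < s → Tendsto (fun n =>
      μ.real {ω | s < |(if X ω ∈ Icc (a n) (b n) then X ω else 0) / b n|} / T (b n)) atTop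
      (𝓝 (max 0 (p * s ^ (-α) - p) + if l = 0 then 0 else
        max 0 (q * s ^ (-α) - q * l ^ (-α)))) := by
    intro s hs
    have hsb : Tendsto (fun n => s * b n) atTop atTop := hb.const_mul_atTop hs
    have h1 : Tendsto (fun n => max 0
        (μ.real {ω | s * b n < X ω} / T (b n) - μ.real {ω | b n < X ω} / T (b n))) atTop
        (𝓝 (max 0 (p * s ^ (-α) - p))) :=
      tendsto_const_nhds.max ((hside (G := fun x => μ.real {ω | x < X ω}) hbalp hs hsb
        (hscale s hs)).sub (hbalp.comp hb))
    have h2 : Tendsto (fun n => max 0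
        (μ.real {ω | X ω < -(s * b n)} / T (b n) - μ.real {ω | X ω < a n} / T (b n))) atTop
        (𝓝 (if l = 0 then 0 else max 0 (q * s ^ (-α) - q * l ^ (-α)))) := by
      split_ifs with hl0
      · refine tendsto_const_nhds.congr' ?_
        rw [hl0] at hab
        filter_upwards [hab.eventually_lt_const hs, hbpos, hTb] with n h3 hbn hTn
        rw [div_lt_iff₀ hbn] at h3
        rw [max_eq_left]
        refine sub_nonpos.2 (div_le_div_of_nonneg_right ?_ hTn.le)
        exact measureReal_mono fun ω (hω : X ω < -(s * b n)) => show X ω < a n by linarith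
      · have h3 := hside (G := fun x => μ.real {ω | X ω < -x}) hbalq
          (hl.lt_of_ne' hl0) (tendsto_neg_atBot_atTop.comp ha) hab
        simp only [Function.comp, neg_neg] at h3
        exact tendsto_const_nhds.max ((hside (G := fun x => μ.real {ω | X ω < -x}) hbalq hs hsb
          (hscale s hs)).sub h3)
    refine (h1.add h2).congr' ?_
    filter_upwards [htail, hTb] with n h3 hTn
    rw [h3 s hs, add_div, ← sub_div, ← sub_div]
    congr 1 <;>
      rw [← max_div_div_right hTn.le, zero_div]
  obtain ⟨c, hc, hconv⟩ := exists_tendsto_integral_pow_div μ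
    (W := fun n ω => |(if X ω ∈ Icc (a n) (b n) then X ω else 0) / b n|)
    (τ := fun n => T (b n)) (s₀ := 1 / 2) (S := l + 2) (C := C + (l + 2) ^ β) (β := β) (k := k)
    (fun n => ((measurable_truncation hX (a n) (b n)).div_const _).abs)
    (fun n ω => abs_nonneg _)
    (fun n j => by
      have := ((memLp_truncation (μ := μ) hX (a n) (b n) j).mul_const (b n)⁻¹).integrable_norm_pow'
      simpa only [div_eq_mul_inv, Real.norm_eq_abs] using this)
    hTb
    ((ae_restrict_iff' measurableSet_Ioi).2 (ae_of_all _ fun s hs => hlim s hs))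
    (by norm_num)
    (by
      refine add_pos_of_pos_of_nonneg (lt_max_of_lt_right ?_) ?_
      · have h1 : (1 : ℝ) < (1 / 2) ^ (-α) :=
          Real.one_lt_rpow_of_pos_of_lt_one_of_neg (by norm_num) (by norm_num) (by linarith)
        nlinarith
      · split_ifs
        · exact le_rfl
        · exact le_max_left _ _)
    (hlim (1 / 2) (by norm_num)) (by linarith)
    (by
      filter_upwards [hb.eventually_ge_atTop x₀, hbpos, hTb] with n hn hbn hTn s hs hsS
      have hTs : μ.real {ω | s < |(if X ω ∈ Icc (a n) (b n) then X ω else 0) / b n|} ≤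
          T (s * b n) := by
        rw [hTdef]
        refine measureReal_mono fun ω (hω : s < _) => ?_
        rw [abs_div, abs_of_pos hbn, lt_div_iff₀ hbn] at hω
        refine hω.trans_le ?_
        split_ifs
        · exact le_rfl
        · simp
      refine (div_le_div_of_nonneg_right hTs hTn.le).trans ?_
      have hsβ : 0 < s ^ (-β) := Real.rpow_pos_of_pos hs _
      have hSβ : 0 < (l + 2) ^ β := Real.rpow_pos_of_pos (by linarith) _
      rcases le_or_gt s 1 with hs1 | hs1
      · have h1 := (hpot (b n) hn).2 (s * b n) (by positivity) (by nlinarith)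
        rw [Real.mul_rpow hs.le hbn.le] at h1
        have hbβ : 0 < b n ^ β := Real.rpow_pos_of_pos hbn _
        have hsβ' : 0 < s ^ β := Real.rpow_pos_of_pos hs _
        have h2 : s ^ β * T (s * b n) ≤ C * T (b n) := by
          refine le_of_mul_le_mul_left ?_ hbβ
          linarith
        have h3 : T (s * b n) / T (b n) ≤ C * s ^ (-β) := by
          rw [Real.rpow_neg hs.le, div_le_iff₀ hTn, mul_right_comm, ← div_eq_mul_inv,
            le_div_iff₀ hsβ']
          linarith
        nlinarith
      · have h1 : T (s * b n) / T (b n) ≤ 1 :=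
          (div_le_one hTn).2 (hT (by nlinarith))
        have h2 : 1 ≤ (l + 2) ^ β * s ^ (-β) := by
          rw [Real.rpow_neg hs.le, ← div_eq_mul_inv, one_le_div (by positivity)]
          exact Real.rpow_le_rpow hs.le hsS.le (by linarith)
        nlinarith)
    (by
      filter_upwards [htail, hbpos, hab.eventually_lt_const (lt_add_one l)] with n h1 hbn h2 s hs
      rw [div_lt_iff₀ hbn] at h2
      rw [h1 s (by linarith), max_eq_left, max_eq_left, add_zero]
      · refine sub_nonpos.2 (measureReal_mono fun ω (hω : X ω < -(s * b n)) => ?_)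
        show X ω < a n
        nlinarith
      · refine sub_nonpos.2 (measureReal_mono fun ω (hω : s * b n < X ω) => ?_)
        show b n < X ω
        nlinarith)
    (by omega)
    (by
      have : (2 : ℝ) ≤ k := by exact_mod_cast hk
      linarith)
  refine ⟨c, hc, hconv.congr' ?_⟩
  filter_upwards [hbpos] with n hbn
  simp only [abs_div, div_pow, abs_of_pos hbn]
  rw [integral_div, div_div]

lemma tendsto_measureReal_lt_abs_atTop {Ω : Type*} [MeasurableSpace Ω] (μ : Measure Ω)
    [IsProbabilityMeasure μ] {X : Ω → ℝ} (hX : Measurable X) :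
    Tendsto (fun x : ℝ => μ.real {ω | x < |X ω|}) atTop (𝓝 0) := by
  have : IsProbabilityMeasure (μ.map fun ω => |X ω|) :=
    Measure.isProbabilityMeasure_map hX.abs.aemeasurable
  have h := (ProbabilityTheory.tendsto_cdf_atTop (μ.map fun ω => |X ω|)).const_sub 1
  rw [sub_self] at h
  refine h.congr fun x => ?_
  rw [ProbabilityTheory.cdf_eq_real, map_measureReal_apply hX.abs measurableSet_Iic,
    ← probReal_compl_eq_one_sub (hX.abs measurableSet_Iic)]
  congr 1
  ext ω
  simp

lemma one_sub_toReal_measure_le {Ω : Type*} [MeasurableSpace Ω] (μ : Measure Ω)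
    [IsProbabilityMeasure μ] {X : Ω → ℝ} (hX : Measurable X) (x : ℝ) :
    1 - (μ {ω | X ω ≤ x}).toReal = μ.real {ω | x < X ω} := by
  rw [← measureReal_def, ← probReal_compl_eq_one_sub (measurableSet_le hX measurable_const)]
  congr 1
  ext ω
  simp

/-- With `X` of distribution function `F` in the domain of attraction of a
stable law of index `α ∈ (0,2)` with balanced tails, and the standardized truncated variable
`Z_{1,n} = (X 1_{[a_n,b_n]}(X) − μ_n)/σ_n`, for every integer `k ≥ 2` there exists `z_k > 0`
such that `E|Z_{1,n}|^k ~ z_k F̄(b_n)^{1−k/2}` as `n → ∞`. -/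
theorem statement5
    {Ω : Type*} [MeasurableSpace Ω] (μ : Measure Ω) [IsProbabilityMeasure μ]
    (X : Ω → ℝ) (hX : Measurable X)
    (F Fstar : ℝ → ℝ)
    (hF : ∀ x : ℝ, F x = (μ {ω | X ω ≤ x}).toReal)
    (hFstar : ∀ x : ℝ, Fstar x = (μ {ω | |X ω| ≤ x}).toReal)
    (α : ℝ) (hα0 : 0 < α) (hα2 : α < 2)
    (hRV : ∀ l : ℝ, 0 < l →
      Tendsto (fun x : ℝ => (1 - Fstar (l * x)) / (1 - Fstar x)) atTop (𝓝 (l ^ (-α))))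
    (p q : ℝ) (hp : 0 < p) (hq : 0 < q) (hpq : p + q = 1)
    (hbalp : Tendsto (fun x : ℝ => (1 - F x) / (1 - Fstar x)) atTop (𝓝 p))
    (hbalq : Tendsto (fun x : ℝ =>
      (μ {ω | X ω < -x}).toReal / (1 - Fstar x)) atTop (𝓝 q))
    (a b : ℕ → ℝ)
    (ha : Tendsto a atTop atBot) (hb : Tendsto b atTop atTop)
    (hab : (∃ L : ℝ, 0 < L ∧ Tendsto (fun n => b n / (-(a n))) atTop (𝓝 L)) ∨
      Tendsto (fun n => b n / (-(a n))) atTop atTop)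
    (μn σn : ℕ → ℝ)
    (hμn : ∀ n : ℕ, μn n = ∫ ω, (if X ω ∈ Set.Icc (a n) (b n) then X ω else 0) ∂μ)
    (hσn : ∀ n : ℕ, σn n = Real.sqrt
      (∫ ω, ((if X ω ∈ Set.Icc (a n) (b n) then X ω else 0) - μn n) ^ 2 ∂μ))
    (Z : ℕ → Ω → ℝ)
    (hZ : ∀ (n : ℕ) (ω : Ω), Z n ω =
      ((if X ω ∈ Set.Icc (a n) (b n) then X ω else 0) - μn n) / σn n) :
    ∀ k : ℕ, 2 ≤ k → ∃ z : ℝ, 0 < z ∧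
      Tendsto (fun n : ℕ =>
          (∫ ω, |Z n ω| ^ k ∂μ) / (z * (1 - F (b n)) ^ (1 - (k : ℝ) / 2)))
        atTop (𝓝 1) := by
  intro k hk
  set T : ℝ → ℝ := fun x => 1 - Fstar x with hTset
  have hTdef : ∀ x, T x = μ.real {ω | x < |X ω|} := fun x => by
    rw [hTset, ← one_sub_toReal_measure_le μ hX.abs, ← hFstar]
  have hFbar : ∀ x, 1 - F x = μ.real {ω | x < X ω} := fun x => by
    rw [hF, one_sub_toReal_measure_le μ hX]
  have hT : Antitone T := fun x y hxy => by
    rw [hTdef, hTdef]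
    exact measureReal_mono fun ω hω => lt_of_le_of_lt hxy hω
  have hT0 : ∀ x, 0 ≤ T x := fun x => by rw [hTdef]; exact measureReal_nonneg
  have hT1 : ∀ x, T x ≤ 1 := fun x => by rw [hTdef]; exact measureReal_le_one
  have hTb : ∀ᶠ n in atTop, 0 < T (b n) :=
    hb.eventually (eventually_pos_of_regularlyVarying hT0 hRV)
  have hbpos := hb.eventually_gt_atTop 0
  obtain ⟨l, hl, hal⟩ : ∃ l : ℝ, 0 ≤ l ∧ Tendsto (fun n => -a n / b n) atTop (𝓝 l) := by
    rcases hab with ⟨L, hL, h⟩ | h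
    · exact ⟨L⁻¹, by positivity, (h.inv₀ hL.ne').congr fun n => inv_div _ _⟩
    · exact ⟨0, le_rfl, h.inv_tendsto_atTop.congr fun n => inv_div _ _⟩
  set Y : ℕ → Ω → ℝ := fun n ω => if X ω ∈ Icc (a n) (b n) then X ω else 0 with hY
  have hmom : ∀ j : ℕ, 2 ≤ j → ∃ c : ℝ, 0 < c ∧ Tendsto (fun n =>
      (∫ ω, |Y n ω| ^ j ∂μ) / (b n ^ j * T (b n))) atTop (𝓝 c) := fun j hj =>
    exists_tendsto_integral_abs_truncation_pow hX hTdef hα0 hα2 hRV hp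
      (by simpa only [hFbar] using hbalp) hbalq ha hb hl hal hj
  have hLp : ∀ n (r : ENNReal), MemLp (Y n) r μ := fun n r => memLp_truncation hX _ _ r
  have hS : Tendsto (fun n => lpNorm (Y n) 2 μ) atTop atTop := by
    obtain ⟨c, hc, hconv⟩ := hmom 2 le_rfl
    have h1 := hconv.pos_mul_atTop hc
      ((tendsto_sq_mul_of_regularlyVarying hT hT0 hT1 hα0 hα2 hRV).comp hb)
    refine (Real.tendsto_sqrt_atTop.comp h1).congr' ?_
    filter_upwards [hbpos, hTb] with n hbn hTn
    simp only [Function.comp]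
    rw [div_mul_cancel₀ _ (by positivity), integral_abs_pow_eq_lpNorm_pow
      (hLp n 2).aestronglyMeasurable two_ne_zero, Nat.cast_ofNat, Real.sqrt_sq lpNorm_nonneg]
  have hmean : Tendsto (fun n => μn n / lpNorm (Y n) 2 μ) atTop (𝓝 0) := by
    simp only [hμn]
    refine tendsto_integral_div_lpNorm_two hX (tendsto_measureReal_lt_abs_atTop μ hX)
      (fun n => hLp n 2) (fun n ω => ?_) hS
    split_ifs <;> simp
  have hcent : ∀ j : ℕ, 2 ≤ j → ∃ c : ℝ, 0 < c ∧ Tendsto (fun n =>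
      (∫ ω, |Y n ω - μn n| ^ j ∂μ) / (b n ^ j * T (b n))) atTop (𝓝 c) := fun j hj => by
    obtain ⟨c, hc, hconv⟩ := hmom j hj
    refine ⟨c, hc, ?_⟩
    have h1 := (tendsto_integral_abs_sub_pow_div (hS.eventually_gt_atTop 0) hmean hj
      fun n => hLp n j).mul hconv
    rw [one_mul] at h1
    refine h1.congr' ?_
    filter_upwards [hconv.eventually_const_lt hc] with n hn
    refine div_mul_div_cancel₀ fun h0 => hn.ne' ?_
    rw [h0, zero_div]
  obtain ⟨c, hc, hck⟩ := hcent k hk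
  obtain ⟨d, hd, hd2⟩ := hcent 2 le_rfl
  have hpr : Tendsto (fun n => (1 - F (b n)) / T (b n)) atTop (𝓝 p) := hbalp.comp hb
  refine ⟨c / (d ^ ((k : ℝ) / 2) * p ^ (1 - (k : ℝ) / 2)), by positivity, ?_⟩
  set z := c / (d ^ ((k : ℝ) / 2) * p ^ (1 - (k : ℝ) / 2)) with hz
  have hz0 : 0 < z := by positivity
  have hlim := (hck.div ((hd2.rpow_const (p := (k : ℝ) / 2) (Or.inl hd.ne')).mul
    (hpr.rpow_const (p := 1 - (k : ℝ) / 2) (Or.inl hp.ne'))) (by positivity)).div_const z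
  rw [← hz, div_self hz0.ne'] at hlim
  refine hlim.congr' ?_
  filter_upwards [hbpos, hTb, hd2.eventually_const_lt hd, hpr.eventually_const_lt hp]
    with n hbn hTn hdn hpn
  set V := ∫ ω, |Y n ω - μn n| ^ 2 ∂μ with hV
  set K := ∫ ω, |Y n ω - μn n| ^ k ∂μ with hK
  set G := 1 - F (b n) with hG
  have hV0 : 0 < V := by
    have := mul_pos hdn (show 0 < b n ^ 2 * T (b n) by positivity)
    rwa [div_mul_cancel₀ _ (by positivity)] at this
  have hG0 : 0 < G := by
    have := mul_pos hpn hTn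
    rwa [div_mul_cancel₀ _ hTn.ne'] at this
  have hσ : σn n ^ k = V ^ ((k : ℝ) / 2) := by
    rw [hσn, Real.sqrt_eq_rpow, ← Real.rpow_natCast, ← Real.rpow_mul (integral_nonneg fun ω => by
      positivity), hV]
    simp only [sq_abs, hY]
    congr 1
    ring
  have hσ0 : 0 ≤ σn n := by rw [hσn]; exact Real.sqrt_nonneg _
  have hZint : ∫ ω, |Z n ω| ^ k ∂μ = K / V ^ ((k : ℝ) / 2) := by
    simp only [hZ, abs_div, div_pow, abs_of_nonneg hσ0]
    rw [integral_div, hσ]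
  have hbk : (b n ^ 2) ^ ((k : ℝ) / 2) = b n ^ k := by
    rw [← Real.rpow_natCast (b n) 2, ← Real.rpow_mul hbn.le, ← Real.rpow_natCast (b n) k]
    congr 1
    push_cast
    ring
  have hTT : T (b n) ^ ((k : ℝ) / 2) * T (b n) ^ (1 - (k : ℝ) / 2) = T (b n) := by
    rw [← Real.rpow_add hTn]
    norm_num
  change K / (b n ^ k * T (b n)) / ((V / (b n ^ 2 * T (b n))) ^ ((k : ℝ) / 2) *
    (G / T (b n)) ^ (1 - (k : ℝ) / 2)) / z = _
  rw [hZint, Real.div_rpow hV0.le (by positivity), Real.div_rpow hG0.le hTn.le,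
    Real.mul_rpow (by positivity) hTn.le, hbk]
  have hV1 : 0 < V ^ ((k : ℝ) / 2) := by positivity
  have hG1 : 0 < G ^ (1 - (k : ℝ) / 2) := by positivity
  have hT2 : 0 < T (b n) ^ ((k : ℝ) / 2) := by positivity
  have hT3 : 0 < T (b n) ^ (1 - (k : ℝ) / 2) := by positivity
  rw [div_mul_div_comm, mul_assoc (b n ^ k), hTT]
  field_simp
end

section
/- Let f : (0,∞) → (0,∞) be regularly varying at infinity of index β. Then there exists a nondecreasing function m : (0,∞) → (0,∞) which tends to infinity at infinity and such that lim_{x→∞} m(x) · sup_{1/m(x) ≤ λ ≤ m(x)} | f(λx)/f(x) − λ^β | = 0. -/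
open Filter Topology Set

/-- A diagonal argument: if each property `P n` holds eventually, then one can let `n` grow to
infinity monotonically with `x` while keeping `P n x`. -/
theorem exists_monotone_tendsto_eventually {P : ℕ → ℝ → Prop}
    (hP : ∀ n, ∀ᶠ x in atTop, P n x) :
    ∃ k : ℝ → ℕ, Monotone k ∧ Tendsto k atTop atTop ∧ ∀ᶠ x in atTop, P (k x) x := by
  classical
  choose X hX using fun n => eventually_atTop.1 (hP n)
  refine ⟨fun x => Nat.findGreatest (fun n => X n ≤ x) ⌊x⌋₊, ?_, ?_, ?_⟩
  · intro x y hxy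
    exact Nat.findGreatest_mono (fun n hn => le_trans hn hxy) (Nat.floor_mono hxy)
  · refine tendsto_atTop.2 fun n => ?_
    filter_upwards [eventually_ge_atTop (X n), eventually_ge_atTop (n : ℝ)] with x hx hn
    exact Nat.le_findGreatest (Nat.le_floor hn) hx
  · filter_upwards [eventually_ge_atTop (X 0)] with x hx
    exact hX _ _ (Nat.findGreatest_spec (P := fun n => X n ≤ x) (Nat.zero_le _) hx)

/-- The truncated increments of `h` tend to zero in mean over bounded intervals. -/
theorem tendsto_integral_min_abs_increment {h : ℝ → ℝ} (hm : Measurable h)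
    (hlim : ∀ u, Tendsto (fun t => h (t + u) - h t) atTop (𝓝 0)) (a b : ℝ) :
    Tendsto (fun t => ∫ y in a..b, min 1 |h (t + y) - h t|) atTop (𝓝 0) := by
  have key := intervalIntegral.tendsto_integral_filter_of_dominated_convergence
    (μ := MeasureTheory.volume) (a := a) (b := b) (l := atTop)
    (F := fun t y => min 1 |h (t + y) - h t|) (f := fun _ => (0 : ℝ)) (fun _ => (1 : ℝ))
    (Eventually.of_forall fun t => by
      apply Measurable.aestronglyMeasurable
      fun_prop)
    (Eventually.of_forall fun t => Eventually.of_forall fun y _ => by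
      rw [Real.norm_of_nonneg (by positivity)]
      exact min_le_left _ _)
    (by simp)
    (Eventually.of_forall fun y _ => by
      simpa using (tendsto_const_nhds (x := (1 : ℝ))).min (hlim y).abs)
  simpa using key

theorem min_one_le_add_min_one {a b c : ℝ} (hb : 0 ≤ b) (hc : 0 ≤ c) (h : a ≤ b + c) :
    min 1 a ≤ min 1 b + min 1 c := by
  grind

/-- The uniform convergence theorem for slowly varying functions, in additive form. -/
theorem eventually_abs_increment_lt {h : ℝ → ℝ} (hm : Measurable h)
    (hlim : ∀ u, Tendsto (fun t => h (t + u) - h t) atTop (𝓝 0)) (A : ℝ) {ε : ℝ}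
    (hε : 0 < ε) : ∀ᶠ t in atTop, ∀ u ∈ Icc (-A) A, |h (t + u) - h t| < ε := by
  set δ : ℝ := min 1 ε
  have hδ0 : 0 < δ := lt_min one_pos hε
  have hint : ∀ t c a b : ℝ, IntervalIntegrable (fun y => min 1 |h (t + (c + y)) - h t|)
      MeasureTheory.volume a b := by
    intro t c a b
    refine (intervalIntegrable_const (c := (1 : ℝ))).mono_fun
      (Measurable.aestronglyMeasurable (by fun_prop)) (Eventually.of_forall fun y => ?_)
    beta_reduce
    rw [Real.norm_of_nonneg (le_min zero_le_one (abs_nonneg _)), norm_one]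
    exact min_le_left _ _
  have h1 := (tendsto_integral_min_abs_increment hm hlim (-A) (A + 1)).eventually
    (gt_mem_nhds (half_pos hδ0))
  have h2 := (tendsto_integral_min_abs_increment hm hlim 0 1).eventually
    (gt_mem_nhds (half_pos hδ0))
  obtain ⟨T, hT⟩ := eventually_atTop.1 h2
  filter_upwards [h1, eventually_ge_atTop (T + A)] with t ht htT u hu
  have h3 := hT (t + u) (by linarith [hu.1])
  have h4 : ∫ y in (0 : ℝ)..1, min 1 |h (t + (u + y)) - h t| ≤
      ∫ y in (-A)..(A + 1), min 1 |h (t + y) - h t| := by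
    rw [intervalIntegral.integral_comp_add_left (fun y => min 1 |h (t + y) - h t|) u]
    refine intervalIntegral.integral_mono_interval (by linarith [hu.1]) (by linarith)
      (by linarith [hu.2]) (Eventually.of_forall fun y => by simp) ?_
    simpa using hint t 0 (-A) (A + 1)
  have h5 : min 1 |h (t + u) - h t| ≤ (∫ y in (0 : ℝ)..1, min 1 |h (t + (u + y)) - h t|) +
      ∫ y in (0 : ℝ)..1, min 1 |h (t + u + y) - h (t + u)| := by
    have hi := hint (t + u) 0 0 1
    simp only [zero_add] at hi
    rw [← intervalIntegral.integral_add (hint t u 0 1) hi]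
    have := intervalIntegral.integral_mono_on (μ := MeasureTheory.volume) zero_le_one
      (intervalIntegrable_const (c := min 1 |h (t + u) - h t|)) ((hint t u 0 1).add hi)
      (fun y _ => by
        have h6 := abs_sub_le (h (t + u)) (h (t + u + y)) (h t)
        rw [abs_sub_comm (h (t + u)) (h (t + u + y))] at h6
        rw [← add_assoc]
        exact min_one_le_add_min_one (abs_nonneg _) (abs_nonneg _) (by linarith))
    simpa using this
  have h9 : min 1 |h (t + u) - h t| < min 1 ε := by linarith
  by_contra! hcon
  exact absurd h9 (not_lt.2 (min_le_min_left 1 hcon))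

/-- The uniform convergence theorem for regularly varying functions. -/
theorem eventually_abs_div_sub_rpow_le {f : ℝ → ℝ} {β : ℝ} (hfmeas : Measurable f)
    (hfpos : ∀ x : ℝ, 0 < x → 0 < f x)
    (hRV : ∀ l : ℝ, 0 < l →
      Tendsto (fun x : ℝ => f (l * x) / f x) atTop (𝓝 (l ^ β)))
    {M ε : ℝ} (hM : 1 ≤ M) (hε : 0 < ε) :
    ∀ᶠ x in atTop, ∀ l ∈ Icc (1 / M) M, |f (l * x) / f x - l ^ β| ≤ ε := by
  set h : ℝ → ℝ := fun t => Real.log (f (Real.exp t)) - β * t with hh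
  have hm : Measurable h := by fun_prop
  have hratio : ∀ t u : ℝ, f (Real.exp u * Real.exp t) / f (Real.exp t) =
      Real.exp (h (t + u) - h t) * Real.exp u ^ β := by
    intro t u
    have e1 := hfpos _ (Real.exp_pos t)
    have e2 := hfpos _ (Real.exp_pos (t + u))
    rw [← Real.exp_mul, ← Real.exp_add, ← Real.exp_add]
    have : h (t + u) - h t + u * β =
        Real.log (f (Real.exp (t + u))) - Real.log (f (Real.exp t)) := by
      simp only [hh]; ring
    rw [this, Real.exp_sub, Real.exp_log e1, Real.exp_log e2, add_comm u t]
  have hlim : ∀ u, Tendsto (fun t => h (t + u) - h t) atTop (𝓝 0) := by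
    intro u
    have hpos : (0 : ℝ) < Real.exp u ^ β := Real.rpow_pos_of_pos (Real.exp_pos u) β
    have k1 := ((hRV _ (Real.exp_pos u)).comp Real.tendsto_exp_atTop).div_const (Real.exp u ^ β)
    rw [div_self hpos.ne'] at k1
    have k2 := (Real.continuousAt_log one_ne_zero).tendsto.comp k1
    rw [Real.log_one] at k2
    refine k2.congr fun t => ?_
    simp only [Function.comp_apply]
    rw [hratio, mul_div_cancel_right₀ _ hpos.ne', Real.log_exp]
  have hM0 : 0 < M := one_pos.trans_le hM
  set C : ℝ := Real.exp (Real.log M * |β|) with hC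
  have hC0 : 0 < C := Real.exp_pos _
  obtain ⟨δ, hδ, hδε⟩ := Metric.continuousAt_iff.1 (Real.continuous_exp.continuousAt (x := 0))
    (ε / C) (div_pos hε hC0)
  have hev := Real.tendsto_log_atTop.eventually
    (eventually_abs_increment_lt hm hlim (Real.log M) hδ)
  filter_upwards [hev, eventually_gt_atTop 0] with x hx hx0 l hl
  have hl0 : 0 < l := (one_div_pos.2 hM0).trans_le hl.1
  have hu : Real.log l ∈ Icc (-Real.log M) (Real.log M) := by
    refine ⟨?_, Real.log_le_log hl0 hl.2⟩
    rw [← Real.log_inv, ← one_div]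
    exact Real.log_le_log (one_div_pos.2 hM0) hl.1
  have k := hratio (Real.log x) (Real.log l)
  rw [Real.exp_log hx0, Real.exp_log hl0] at k
  have hd := @hδε (h (Real.log x + Real.log l) - h (Real.log x))
    (by simpa [Real.dist_eq] using hx _ hu)
  rw [Real.dist_eq, Real.exp_zero] at hd
  have hlC : l ^ β ≤ C := by
    rw [Real.rpow_def_of_pos hl0, hC]
    refine Real.exp_le_exp.2 ((le_abs_self _).trans ?_)
    rw [abs_mul]
    exact mul_le_mul_of_nonneg_right (abs_le.2 hu) (abs_nonneg β)
  have hlb : 0 < l ^ β := Real.rpow_pos_of_pos hl0 β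
  rw [k, ← sub_one_mul, abs_mul, abs_of_pos hlb]
  calc _ ≤ ε / C * C := mul_le_mul hd.le hlC hlb.le (div_pos hε hC0).le
    _ = ε := div_mul_cancel₀ _ hC0.ne'

/-- For a regularly varying function `f` of index `β`, there is a
nondecreasing function `m` tending to infinity such that the convergence in the definition
of regular variation is uniform over `λ ∈ [1/m(x), m(x)]`, at rate `o(1/m(x))`. -/
theorem statement8 (f : ℝ → ℝ) (β : ℝ) (hfmeas : Measurable f)
    (hfpos : ∀ x : ℝ, 0 < x → 0 < f x)
    (hRV : ∀ l : ℝ, 0 < l →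
      Tendsto (fun x : ℝ => f (l * x) / f x) atTop (𝓝 (l ^ β))) :
    ∃ m : ℝ → ℝ, (∀ x : ℝ, 0 < x → 0 < m x) ∧ MonotoneOn m (Set.Ioi 0) ∧
      Tendsto m atTop atTop ∧
      Tendsto (fun x : ℝ =>
          m x * ⨆ l ∈ Set.Icc (1 / m x) (m x), |f (l * x) / f x - l ^ β|)
        atTop (𝓝 0) := by
  obtain ⟨k, hkmono, hktop, hk⟩ := exists_monotone_tendsto_eventually
    (P := fun n x => ∀ l ∈ Icc (1 / ((n : ℝ) + 1)) ((n : ℝ) + 1),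
      |f (l * x) / f x - l ^ β| ≤ 1 / ((n : ℝ) + 1) ^ 2)
    (fun n => eventually_abs_div_sub_rpow_le hfmeas hfpos hRV (by simp) (by positivity))
  have hmtop : Tendsto (fun x => (k x : ℝ) + 1) atTop atTop :=
    tendsto_atTop_add_const_right _ _ (tendsto_natCast_atTop_atTop.comp hktop)
  refine ⟨fun x => (k x : ℝ) + 1, fun x _ => by positivity, ?_, hmtop, ?_⟩
  · intro x _ y _ hxy
    have := hkmono hxy
    simpa using this
  · refine squeeze_zero' (Eventually.of_forall fun x => ?_) ?_ hmtop.inv_tendsto_atTop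
    · exact mul_nonneg (by positivity)
        (Real.iSup_nonneg fun l => Real.iSup_nonneg fun _ => abs_nonneg _)
    · filter_upwards [hk] with x hx
      have hpos : (0 : ℝ) < (k x : ℝ) + 1 := by positivity
      calc _ ≤ ((k x : ℝ) + 1) * (1 / ((k x : ℝ) + 1) ^ 2) :=
            mul_le_mul_of_nonneg_left (Real.iSup_le (fun l => Real.iSup_le (fun hl => hx l hl)
              (by positivity)) (by positivity)) hpos.le
        _ = ((k x : ℝ) + 1)⁻¹ := by field_simp
end
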